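/- arXiv:2210.03111 — 3 statements merged into one kernel-verified Lean document; each statement's English description precedes it below -/
import Mathlib

section
/- Let A ⊂ V = ℂ^N be a finite set of nonzero vectors contained in a lattice of rank N, with multiplicities c_α ∈ ℂ, and suppose C_δ^{α₀} ≠ 0 for every α ∈ A, every subset δ ⊆ δ_α and every α₀ ∈ δ_α. Then the commutativity equations F_i F_j = F_j F_i for the prepotential F(x) = Σ_{α∈A} c_α f((α,x)) (with f'''(z) = cot z) imply: (1) (A,c) is a Euclidean trigonometric ∨-system, and (2) Σ_{α,β∈A₊} c_α c_β (α,β) B_{α,β}(a,b) (α∧β) = 0 for all a,b ∈ V, where A₊ is a positive system obtained from A by sign changes. Conversely, if (A,c) satisfies conditions (1) and (2) then the commutativity equations hold for F. -/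
open scoped BigOperators

/-- `γ` is collinear to `α`. -/
def Collin {V : Type*} [AddCommGroup V] [Module ℂ V] (α γ : V) : Prop :=
  ∃ k : ℂ, γ = k • α

/-- `Γ` is a (maximal, nonempty) `α`-string of the configuration `A`. -/
def IsString {V : Type*} [AddCommGroup V] [Module ℂ V]
    (A : Finset V) (α : V) (Γ : Finset V) : Prop :=
  Γ.Nonempty ∧
  (∀ γ ∈ Γ, γ ∈ A ∧ ¬ Collin α γ) ∧
  (∀ γ₁ ∈ Γ, ∀ γ₂ ∈ Γ, ∃ m : ℤ, γ₁ + γ₂ = (m : ℂ) • α ∨ γ₁ - γ₂ = (m : ℂ) • α) ∧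
  (∀ γ ∈ Γ, ∀ β ∈ A, ¬ Collin α β →
    (∃ m : ℤ, β = γ + (m : ℂ) • α ∨ β = -γ + (m : ℂ) • α) → β ∈ Γ)

/-- `(A, c)` is a Euclidean trigonometric ∨-system with respect to the
bilinear form `g`: for every `α ∈ A` and every `α`-string `Γ`,
`Σ_{β∈Γ} c_β (α,β) α∧β = 0`. -/
def IsEuclidTrigVSystem {V : Type*} [AddCommGroup V] [Module ℂ V]
    (g : V → V → ℂ) (A : Finset V) (c : V → ℂ) : Prop :=
  ∀ α ∈ A, ∀ Γ : Finset V, IsString A α Γ →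
    ∀ a b : V, ∑ β ∈ Γ, c β * g α β * (g α a * g β b - g α b * g β a) = 0

/-- The standard bilinear form on `ℂ^N`. -/
noncomputable def dotc {N : ℕ} (u v : Fin N → ℂ) : ℂ := ∑ k, u k * v k

/-- Complex cotangent. -/
noncomputable def ccot (z : ℂ) : ℂ := Complex.cos z / Complex.sin z

/-- The matrix `F_i` of third derivatives of the trigonometric prepotential
`F = Σ_{α∈A} c_α f((α,x))`, `f''' = cot`:
`(F_i)_{pq} = Σ_{α∈A} c_α α_i α_p α_q cot((α,x))`. -/
noncomputable def Tmat {N : ℕ} (A : Finset (Fin N → ℂ)) (c : (Fin N → ℂ) → ℂ)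
    (x : Fin N → ℂ) (i : Fin N) : Matrix (Fin N) (Fin N) ℂ :=
  Matrix.of fun p q => ∑ α ∈ A, c α * α i * α p * α q * ccot (dotc α x)

open Filter Topology

section Dotc

variable {N : ℕ}

lemma dotc_add_left (u v w : Fin N → ℂ) : dotc (u + v) w = dotc u w + dotc v w :=
  add_dotProduct u v w

lemma dotc_add_right (u v w : Fin N → ℂ) : dotc u (v + w) = dotc u v + dotc u w :=
  dotProduct_add u v w

lemma dotc_smul_left (k : ℂ) (u v : Fin N → ℂ) : dotc (k • u) v = k * dotc u v :=
  smul_dotProduct k u v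

lemma dotc_smul_right (k : ℂ) (u v : Fin N → ℂ) : dotc u (k • v) = k * dotc u v :=
  dotProduct_smul k u v

lemma dotc_sub_left (u v w : Fin N → ℂ) : dotc (u - v) w = dotc u w - dotc v w :=
  sub_dotProduct u v w

lemma dotc_sub_right (u v w : Fin N → ℂ) : dotc u (v - w) = dotc u v - dotc u w :=
  dotProduct_sub u v w

lemma dotc_neg_left (u v : Fin N → ℂ) : dotc (-u) v = -dotc u v :=
  neg_dotProduct u v

lemma dotc_comm (u v : Fin N → ℂ) : dotc u v = dotc v u :=
  dotProduct_comm u v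

lemma dotc_single (u : Fin N → ℂ) (i : Fin N) : dotc u (Pi.single i 1) = u i :=
  dotProduct_single_one u i

lemma dotc_zero_left (u : Fin N → ℂ) : dotc 0 u = 0 := zero_dotProduct u

lemma exists_dotc_ne_zero {α : Fin N → ℂ} (hα : α ≠ 0) : ∃ v, dotc α v ≠ 0 := by
  obtain ⟨i, hi⟩ := Function.ne_iff.mp hα
  exact ⟨Pi.single i 1, by rwa [dotc_single]⟩

/-- The wedge `α ∧ β` as a function of two vectors. -/
noncomputable def wedge (α β a b : Fin N → ℂ) : ℂ := dotc α a * dotc β b - dotc α b * dotc β a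

lemma wedge_smul_add_right (α β a b : Fin N → ℂ) (s m : ℂ) :
    wedge α (s • β + m • α) a b = s * wedge α β a b := by
  simp only [wedge, dotc_add_left, dotc_smul_left]; ring

lemma wedge_smul_left (α β a b : Fin N → ℂ) (k : ℂ) :
    wedge (k • α) β a b = k * wedge α β a b := by
  simp only [wedge, dotc_smul_left]; ring

lemma wedge_eq_zero_of_collin {α β γ : Fin N → ℂ} (hβ : Collin α β) (hγ : Collin α γ)
    (a b : Fin N → ℂ) : wedge β γ a b = 0 := by
  obtain ⟨k, rfl⟩ := hβ
  obtain ⟨l, rfl⟩ := hγ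
  simp only [wedge, dotc_smul_left]; ring

lemma exists_wedge_ne_zero {α β : Fin N → ℂ} (hα : α ≠ 0) (h : ¬ Collin α β) :
    ∃ a b, wedge α β a b ≠ 0 := by
  by_contra! hw
  obtain ⟨i, hi⟩ := Function.ne_iff.mp hα
  replace hi : α i ≠ 0 := hi
  refine h ⟨β i / α i, funext fun j => ?_⟩
  have := hw (Pi.single i 1) (Pi.single j 1)
  simp only [wedge, dotc_single] at this
  simp only [Pi.smul_apply, smul_eq_mul]
  field_simp
  linear_combination this

lemma exists_dotc_eq_zero_and_ne_zero {α β : Fin N → ℂ} (h : ¬ Collin α β) :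
    ∃ w, dotc α w = 0 ∧ dotc β w ≠ 0 := by
  by_cases hα : α = 0
  · subst hα
    obtain ⟨v, hv⟩ := exists_dotc_ne_zero (α := β) (fun h0 => h ⟨0, by simp [h0]⟩)
    exact ⟨v, dotc_zero_left v, hv⟩
  · obtain ⟨a, b, hab⟩ := exists_wedge_ne_zero hα h
    refine ⟨dotc α a • b - dotc α b • a, ?_, ?_⟩
    · simp only [dotc_sub_right, dotc_smul_right]; ring
    · simpa only [dotc_sub_right, dotc_smul_right, wedge] using hab

/-- A finite set of vectors not collinear to `α` admits a vector orthogonal to `α` whose pairings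
with the set have nonzero real parts. -/
lemma exists_generic (α : Fin N → ℂ) (S : Finset (Fin N → ℂ)) (hS : ∀ s ∈ S, ¬ Collin α s) :
    ∃ w, dotc α w = 0 ∧ ∀ s ∈ S, (dotc s w).re ≠ 0 := by
  let D (s : Fin N → ℂ) : (Fin N → ℂ) →ₗ[ℂ] ℂ :=
    { toFun := dotc s
      map_add' := dotc_add_right s
      map_smul' := fun k v => dotc_smul_right k s v }
  obtain ⟨w, hw, hw'⟩ := Module.Dual.exists_forall_mem_ne_zero_of_forall_exists (K := ℝ)
    ((LinearMap.ker (D α)).restrictScalars ℝ)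
    (fun s : S => Complex.reLm ∘ₗ (D s).restrictScalars ℝ) (fun ⟨s, hs⟩ => by
      obtain ⟨w, h0, h1⟩ := exists_dotc_eq_zero_and_ne_zero (hS s hs)
      refine ⟨(starRingEnd ℂ (dotc s w)) • w, ?_, ?_⟩
      · simp [D, h0]
      · have : (starRingEnd ℂ) (dotc s w) * dotc s w = ((Complex.normSq (dotc s w) : ℝ) : ℂ) := by
          rw [mul_comm, Complex.mul_conj]
        simpa [D, dotc_smul_right, this] using h1)
  exact ⟨w, by simpa [D] using hw, fun s hs => by simpa [D] using hw' ⟨s, hs⟩⟩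

end Dotc

section Cot

lemma ccot_eq_exp (z : ℂ) :
    ccot z = -Complex.I * ((1 + Complex.exp (2 * Complex.I * z)) /
      (1 - Complex.exp (2 * Complex.I * z))) := by
  have h : ccot z = Complex.cot z := rfl
  rw [h, Complex.cot_eq_exp_ratio, div_mul_eq_div_div, add_comm, Complex.div_I]
  ring

lemma sin_ne_zero_of_exp_ne_one {z : ℂ} (h : Complex.exp (2 * Complex.I * z) ≠ 1) :
    Complex.sin z ≠ 0 := by
  intro hz
  obtain ⟨k, rfl⟩ := Complex.sin_eq_zero_iff.mp hz
  exact h (Complex.exp_eq_one_iff.mpr ⟨k, by ring⟩)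

lemma ccot_neg (z : ℂ) : ccot (-z) = -ccot z := by
  simp [ccot, div_neg]

lemma ccot_add_int_mul_pi (z : ℂ) (n : ℤ) : ccot (z + n * Real.pi) = ccot z := by
  simp only [ccot_eq_exp]
  rw [show 2 * Complex.I * (z + n * Real.pi) = 2 * Complex.I * z + n * (2 * Real.pi * Complex.I) by
    ring, Complex.exp_periodic.int_mul n]

lemma differentiableAt_ccot {z : ℂ} (h : Complex.sin z ≠ 0) : DifferentiableAt ℂ ccot z :=
  Complex.differentiableAt_cos.div Complex.differentiableAt_sin h

lemma cos_ne_zero_of_sin_eq_zero {z : ℂ} (h : Complex.sin z = 0) : Complex.cos z ≠ 0 := by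
  intro h'
  simpa [h, h'] using Complex.sin_sq_add_cos_sq z

lemma hasDerivAt_sin_affine (a p : ℂ) :
    HasDerivAt (fun t : ℂ => Complex.sin (a + t * p)) (Complex.cos a * p) 0 := by
  have h : HasDerivAt (fun t : ℂ => a + t * p) p 0 := by
    simpa using ((hasDerivAt_id (0 : ℂ)).mul_const p).const_add a
  simpa using h.csin

lemma eventually_sin_affine_ne_zero {a p : ℂ} (h : Complex.sin a = 0 → p ≠ 0) :
    ∀ᶠ t : ℂ in 𝓝[≠] 0, Complex.sin (a + t * p) ≠ 0 := by
  by_cases ha : Complex.sin a = 0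
  · exact (hasDerivAt_sin_affine a p).eventually_ne
      (mul_ne_zero (cos_ne_zero_of_sin_eq_zero ha) (h ha))
  · refine ((hasDerivAt_sin_affine a p).continuousAt.eventually_ne ?_).filter_mono
      nhdsWithin_le_nhds
    simpa using ha

lemma tendsto_ccot_affine {a : ℂ} (p : ℂ) (h : Complex.sin a ≠ 0) :
    Tendsto (fun t : ℂ => ccot (a + t * p)) (𝓝[≠] 0) (𝓝 (ccot a)) := by
  have h1 : Tendsto (fun t : ℂ => a + t * p) (𝓝[≠] 0) (𝓝 a) := by
    have : Continuous fun t : ℂ => a + t * p := by fun_prop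
    simpa using (this.tendsto 0).mono_left nhdsWithin_le_nhds
  exact (differentiableAt_ccot h).continuousAt.tendsto.comp h1

/-- `t * cot (a + t p)` tends to the residue `1 / p` at a pole, and to `0` elsewhere. -/
lemma tendsto_mul_ccot_affine {a p : ℂ} (h : Complex.sin a = 0 → p ≠ 0) :
    Tendsto (fun t : ℂ => t * ccot (a + t * p)) (𝓝[≠] 0)
      (𝓝 (if Complex.sin a = 0 then p⁻¹ else 0)) := by
  split_ifs with ha
  · have hc := cos_ne_zero_of_sin_eq_zero ha
    have h1 := (hasDerivAt_iff_tendsto_slope_zero.mp (hasDerivAt_sin_affine a p))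
    have h2 : Tendsto (fun t : ℂ => Complex.cos (a + t * p)) (𝓝[≠] 0) (𝓝 (Complex.cos a)) := by
      have : Continuous fun t : ℂ => Complex.cos (a + t * p) := by fun_prop
      simpa using (this.tendsto 0).mono_left nhdsWithin_le_nhds
    have h3 := h2.div h1 (mul_ne_zero hc (h ha))
    rw [show Complex.cos a / (Complex.cos a * p) = p⁻¹ by
      field_simp] at h3
    refine h3.congr fun t => ?_
    simp only [ccot, Pi.div_apply, zero_add, zero_mul, add_zero, ha, sub_zero, smul_eq_mul,
      div_eq_mul_inv, mul_inv, inv_inv]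
    ring
  · have h1 : Tendsto (fun t : ℂ => t) (𝓝[≠] (0 : ℂ)) (𝓝 0) := nhdsWithin_le_nhds
    simpa using h1.mul (tendsto_ccot_affine p ha)

lemma tendsto_exp_two_I_mul :
    Tendsto (fun z : ℂ => Complex.exp (2 * Complex.I * z)) (comap Complex.im atTop) (𝓝 0) := by
  refine Complex.tendsto_exp_comap_re_atBot.comp (tendsto_comap_iff.mpr ?_)
  have : Tendsto (fun z : ℂ => -(2 * z.im)) (comap Complex.im atTop) atBot :=
    tendsto_neg_atTop_atBot.comp (tendsto_comap.const_mul_atTop two_pos)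
  exact this.congr fun z => by simp

lemma tendsto_ccot_atTop : Tendsto ccot (comap Complex.im atTop) (𝓝 (-Complex.I)) := by
  have h := ((tendsto_exp_two_I_mul.const_add 1).div (tendsto_exp_two_I_mul.const_sub 1)
    (by simp)).const_mul (-Complex.I)
  simp only [add_zero, sub_zero, div_one, mul_one] at h
  exact h.congr fun z => (ccot_eq_exp z).symm

lemma tendsto_ccot_atBot : Tendsto ccot (comap Complex.im atBot) (𝓝 Complex.I) := by
  have h1 : Tendsto (fun z : ℂ => -z) (comap Complex.im atBot) (comap Complex.im atTop) :=
    tendsto_comap_iff.mpr (by simpa [Function.comp_def] using tendsto_comap)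
  have h := (tendsto_ccot_atTop.comp h1).neg
  simpa [Function.comp_def, ccot_neg] using h

lemma eventually_sin_ne_zero_atTop : ∀ᶠ z in comap Complex.im atTop, Complex.sin z ≠ 0 := by
  filter_upwards [tendsto_exp_two_I_mul.eventually_ne zero_ne_one] with z hz
  exact sin_ne_zero_of_exp_ne_one hz

lemma eventually_sin_ne_zero_atBot : ∀ᶠ z in comap Complex.im atBot, Complex.sin z ≠ 0 := by
  have h1 : Tendsto (fun z : ℂ => -z) (comap Complex.im atBot) (comap Complex.im atTop) :=
    tendsto_comap_iff.mpr (by simpa [Function.comp_def] using tendsto_comap)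
  filter_upwards [h1.eventually eventually_sin_ne_zero_atTop] with z hz
  simpa using hz

end Cot

section Characters

/-- Cayley transforms `(1 + χ) / (1 - χ)` of distinct characters contracted to `0` along a common
path are linearly independent. -/
lemma coeff_eq_zero_of_sum_cayley_eq_zero {M : Type*} [CommMonoid M] (T : Finset (M →* ℂ))
    (e : (M →* ℂ) → ℂ) (path : ℝ → M) (ρ : (M →* ℂ) → ℂ)
    (hpath : ∀ χ ∈ T, ∀ t : ℝ, χ (path t) = Complex.exp (-(ρ χ * t)))
    (hpos : ∀ χ ∈ T, 0 < (ρ χ).re)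
    (htie : ∀ χ ∈ T, ∀ χ' ∈ T, (ρ χ).re = (ρ χ').re → ρ χ = ρ χ')
    (hsum : ∀ x : M, (∀ χ ∈ T, χ x ≠ 1) → ∑ χ ∈ T, e χ * ((1 + χ x) / (1 - χ x)) = 0) :
    ∀ χ ∈ T, e χ = 0 := by
  classical
  by_contra! hne
  obtain ⟨χ₁, hχ₁, he₁⟩ := hne
  obtain ⟨χ₀, hχ₀, hmin⟩ := (T.filter (e · ≠ 0)).exists_min_image (fun χ => (ρ χ).re)
    ⟨χ₁, by simp [hχ₁, he₁]⟩
  obtain ⟨hχ₀, he₀⟩ := Finset.mem_filter.mp hχ₀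
  have hdecay : ∀ z : ℂ, 0 < z.re →
      Tendsto (fun t : ℝ => Complex.exp (-(z * t))) atTop (𝓝 0) := fun z hz => by
    refine Complex.tendsto_exp_comap_re_atBot.comp (tendsto_comap_iff.mpr ?_)
    have : Tendsto (fun t : ℝ => -(z.re * t)) atTop atBot :=
      tendsto_neg_atTop_atBot.comp (tendsto_id.const_mul_atTop hz)
    exact this.congr fun t => by simp
  have hval : ∀ χ ∈ T, ∀ y t, χ (y * path t) = χ y * Complex.exp (-(ρ χ * t)) :=
    fun χ hχ y t => by rw [map_mul, hpath χ hχ]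
  have hχlim : ∀ χ ∈ T, ∀ y, Tendsto (fun t => χ (y * path t)) atTop (𝓝 0) := fun χ hχ y => by
    simp only [hval χ hχ]
    simpa using (hdecay _ (hpos χ hχ)).const_mul (χ y)
  have hzero : ∀ y, ∀ᶠ t in atTop,
      ∑ χ ∈ T, e χ * ((1 + χ (y * path t)) / (1 - χ (y * path t))) = 0 := fun y => by
    have : ∀ᶠ t in atTop, ∀ χ ∈ T, χ (y * path t) ≠ 1 :=
      (Finset.eventually_all T).mpr fun χ hχ => (hχlim χ hχ y).eventually_ne zero_ne_one
    filter_upwards [this] with t ht using hsum _ ht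
  have htotal : ∑ χ ∈ T, e χ = 0 := by
    have hl : Tendsto (fun t => ∑ χ ∈ T, e χ * ((1 + χ (1 * path t)) / (1 - χ (1 * path t))))
        atTop (𝓝 (∑ χ ∈ T, e χ * ((1 + 0) / (1 - 0)))) :=
      tendsto_finsetSum _ fun χ hχ => (((hχlim χ hχ 1).const_add 1).div
        ((hχlim χ hχ 1).const_sub 1) (by simp)).const_mul _
    have := tendsto_nhds_unique (hl.congr' (hzero 1)) tendsto_const_nhds
    simpa using this
  have hlead : ∀ y, ∑ χ ∈ T, (if ρ χ = ρ χ₀ then e χ else 0) * χ y = 0 := fun y => by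
    have hl : Tendsto (fun t : ℝ => ∑ χ ∈ T, e χ * χ y *
        (Complex.exp (-((ρ χ - ρ χ₀) * t)) / (1 - χ (y * path t)))) atTop
        (𝓝 (∑ χ ∈ T, (if ρ χ = ρ χ₀ then e χ else 0) * χ y)) := by
      refine tendsto_finsetSum _ fun χ hχ => ?_
      by_cases hρ : ρ χ = ρ χ₀
      · simpa [hρ] using (((hχlim χ hχ y).const_sub 1).inv₀ (by simp)).const_mul (e χ * χ y)
      · by_cases he : e χ = 0
        · simp [he]
        · have hlt : (ρ χ₀).re < (ρ χ).re :=
            lt_of_le_of_ne (hmin χ (by simp [hχ, he]))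
              fun h => hρ (htie χ hχ χ₀ hχ₀ h.symm)
          simpa [hρ] using ((hdecay (ρ χ - ρ χ₀) (by simpa using hlt)).div
            ((hχlim χ hχ y).const_sub 1) (by simp)).const_mul (e χ * χ y)
    refine tendsto_nhds_unique hl (tendsto_const_nhds.congr' ?_)
    have hne1 : ∀ᶠ t in atTop, ∀ χ ∈ T, χ (y * path t) ≠ 1 :=
      (Finset.eventually_all T).mpr fun χ hχ => (hχlim χ hχ y).eventually_ne zero_ne_one
    filter_upwards [hzero y, hne1] with t ht hne
    have key : ∑ χ ∈ T, e χ * ((1 + χ (y * path t)) / (1 - χ (y * path t))) = ∑ χ ∈ T, e χ +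
        2 * Complex.exp (-(ρ χ₀ * t)) * ∑ χ ∈ T, e χ * χ y *
          (Complex.exp (-((ρ χ - ρ χ₀) * t)) / (1 - χ (y * path t))) := by
      rw [Finset.mul_sum, ← Finset.sum_add_distrib]
      refine Finset.sum_congr rfl fun χ hχ => ?_
      have h1 : 1 - χ (y * path t) ≠ 0 := sub_ne_zero.mpr (hne χ hχ).symm
      have h2 : Complex.exp (-(ρ χ₀ * t)) * Complex.exp (-((ρ χ - ρ χ₀) * t)) =
          Complex.exp (-(ρ χ * t)) := by rw [← Complex.exp_add]; ring_nf
      have h3 := hval χ hχ y t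
      rw [← h2] at h3
      generalize Complex.exp (-((ρ χ - ρ χ₀) * t)) = E at h3 ⊢
      field_simp
      linear_combination 2 * e χ * h3
    rw [ht, htotal, zero_add] at key
    symm
    simpa using key
  have := linearIndependent_iff'.mp (linearIndependent_monoidHom M ℂ) T
    (fun χ => if ρ χ = ρ χ₀ then e χ else 0)
    (funext fun y => by simpa only [Finset.sum_apply, Pi.smul_apply, smul_eq_mul,
      Pi.zero_apply] using hlead y) χ₀ hχ₀
  exact he₀ (by simpa using this)

end Characters

section Residues

variable {N : ℕ}

/-- The coefficient of `cot (α, x) cot (β, x)` in the commutator of the matrices `F_a`, `F_b`. -/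
noncomputable def pairWeight (c : (Fin N → ℂ) → ℂ) (a b a' b' α β : Fin N → ℂ) : ℂ :=
  wedge α β a b * wedge α β a' b' * (c α * c β * dotc α β)

/-- The commutator of `F_a` and `F_b` at `x`, contracted with `a' ∧ b'`. -/
noncomputable def commSum (A : Finset (Fin N → ℂ)) (c : (Fin N → ℂ) → ℂ)
    (a b a' b' x : Fin N → ℂ) : ℂ :=
  ∑ α ∈ A, ∑ β ∈ A, pairWeight c a b a' b' α β * (ccot (dotc α x) * ccot (dotc β x))

open Classical in
/-- The residue of `commSum` at the hyperplanes `(α, x) ∈ π ℤ`, up to a factor. -/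
noncomputable def residueSum (A : Finset (Fin N → ℂ)) (c : (Fin N → ℂ) → ℂ)
    (α a b a' b' x : Fin N → ℂ) : ℂ :=
  ∑ β ∈ A with ¬ Collin α β,
    c β * dotc α β * wedge α β a b * wedge α β a' b' * ccot (dotc β x)

lemma pairWeight_comm (c : (Fin N → ℂ) → ℂ) (a b a' b' α β : Fin N → ℂ) :
    pairWeight c a b a' b' α β = pairWeight c a b a' b' β α := by
  simp only [pairWeight, wedge, dotc_comm α β]; ring

lemma pairWeight_eq_zero_of_collin (c : (Fin N → ℂ) → ℂ) (a b a' b' : Fin N → ℂ)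
    {α β γ : Fin N → ℂ} (hβ : Collin α β) (hγ : Collin α γ) :
    pairWeight c a b a' b' β γ = 0 := by
  simp [pairWeight, wedge_eq_zero_of_collin hβ hγ]

lemma Collin.eq_div_smul {α γ v : Fin N → ℂ} (h : Collin α γ) (hv : dotc α v ≠ 0) :
    γ = (dotc γ v / dotc α v) • α := by
  obtain ⟨k, rfl⟩ := h
  rw [dotc_smul_left, mul_div_cancel_right₀ _ hv]

lemma Collin.dotc_ne_zero {α γ v : Fin N → ℂ} (h : Collin α γ) (hγ : γ ≠ 0)
    (hv : dotc α v ≠ 0) : dotc γ v ≠ 0 := by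
  intro h0
  have := h.eq_div_smul hv
  rw [h0, zero_div, zero_smul] at this
  exact hγ this

open Classical in
lemma tendsto_mul_commSum (A : Finset (Fin N → ℂ)) (hA0 : ∀ α ∈ A, α ≠ 0)
    (c : (Fin N → ℂ) → ℂ) (a b a' b' : Fin N → ℂ) {α x v : Fin N → ℂ} (hv : dotc α v ≠ 0)
    (hx : ∀ γ ∈ A, Complex.sin (dotc γ x) = 0 → Collin α γ) :
    Tendsto (fun t : ℂ => t * commSum A c a b a' b' (x + t • v)) (𝓝[≠] 0)
      (𝓝 (2 / dotc α v *
        (∑ γ ∈ A with Complex.sin (dotc γ x) = 0, c γ * (dotc γ v / dotc α v) ^ 2) *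
        residueSum A c α a b a' b' x)) := by
  set r : (Fin N → ℂ) → ℂ := fun γ => if Complex.sin (dotc γ x) = 0 then (dotc γ v)⁻¹ else 0
    with hr
  have hlim : Tendsto (fun t : ℂ => t * commSum A c a b a' b' (x + t • v)) (𝓝[≠] 0)
      (𝓝 (∑ γ ∈ A, ∑ β ∈ A, pairWeight c a b a' b' γ β *
        (r γ * ccot (dotc β x) + ccot (dotc γ x) * r β))) := by
    simp only [commSum, Finset.mul_sum]
    refine tendsto_finsetSum _ fun γ hγ => tendsto_finsetSum _ fun β hβ => ?_
    simp only [dotc_add_right, dotc_smul_right, mul_left_comm _ (pairWeight c a b a' b' γ β)]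
    by_cases hw : pairWeight c a b a' b' γ β = 0
    · simp [hw]
    · refine Tendsto.const_mul _ ?_
      have hp : ∀ γ ∈ A, Complex.sin (dotc γ x) = 0 → dotc γ v ≠ 0 := fun γ hγ h0 =>
        (hx γ hγ h0).dotc_ne_zero (hA0 γ hγ) hv
      by_cases hγ0 : Complex.sin (dotc γ x) = 0
      · have hβ0 : Complex.sin (dotc β x) ≠ 0 := fun h0 =>
          hw (pairWeight_eq_zero_of_collin c a b a' b' (hx γ hγ hγ0) (hx β hβ h0))
        have := (tendsto_mul_ccot_affine (hp γ hγ)).mul (tendsto_ccot_affine (dotc β v) hβ0)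
        simpa [hr, hβ0, mul_assoc] using this
      · have := (tendsto_ccot_affine (dotc γ v) hγ0).mul (tendsto_mul_ccot_affine (hp β hβ))
        simpa [hr, hγ0, mul_left_comm] using this
  convert hlim using 2
  have hsymm : ∑ γ ∈ A, ∑ β ∈ A, pairWeight c a b a' b' γ β *
        (r γ * ccot (dotc β x) + ccot (dotc γ x) * r β) =
      2 * ∑ γ ∈ A, ∑ β ∈ A, pairWeight c a b a' b' γ β * (r γ * ccot (dotc β x)) := by
    simp only [mul_add, Finset.sum_add_distrib]
    rw [two_mul]
    congr 1
    rw [Finset.sum_comm]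
    refine Finset.sum_congr rfl fun γ _ => Finset.sum_congr rfl fun β _ => ?_
    rw [pairWeight_comm]; ring
  rw [hsymm, residueSum, mul_assoc, Finset.sum_mul_sum, div_mul_eq_mul_div, mul_div_assoc]
  congr 1
  rw [Finset.sum_div, Finset.sum_filter]
  refine Finset.sum_congr rfl fun γ hγ => ?_
  by_cases hγ0 : Complex.sin (dotc γ x) = 0
  · have hcol := hx γ hγ hγ0
    rw [if_pos hγ0, Finset.sum_filter, Finset.sum_div]
    refine Finset.sum_congr rfl fun β _ => ?_
    by_cases hβ : Collin α β
    · simp [hβ, pairWeight_eq_zero_of_collin c a b a' b' hcol hβ]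
    · have hγv := hcol.dotc_ne_zero (hA0 γ hγ) hv
      have hγe := hcol.eq_div_smul hv
      simp only [hβ, not_false_eq_true, if_true, hr, hγ0]
      have h1 : dotc γ β = dotc γ v / dotc α v * dotc α β := by
        conv_lhs => rw [hγe, dotc_smul_left]
      have h2 : ∀ a b, wedge γ β a b = dotc γ v / dotc α v * wedge α β a b := fun a b => by
        conv_lhs => rw [hγe, wedge_smul_left]
      rw [pairWeight, h1, h2, h2]
      field_simp
  · simp [hr, hγ0]

lemma eventually_sin_line_ne_zero (A : Finset (Fin N → ℂ)) (x v : Fin N → ℂ)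
    (h : ∀ γ ∈ A, Complex.sin (dotc γ x) = 0 → dotc γ v ≠ 0) :
    ∀ᶠ t : ℂ in 𝓝[≠] 0, ∀ γ ∈ A, Complex.sin (dotc γ (x + t • v)) ≠ 0 := by
  refine (Finset.eventually_all A).mpr fun γ hγ => ?_
  simpa only [dotc_add_right, dotc_smul_right] using eventually_sin_affine_ne_zero (h γ hγ)

/-- The residue of the commutator vanishes when all `α`-strings cancel. -/
lemma residueSum_eq_zero (A : Finset (Fin N → ℂ)) (c : (Fin N → ℂ) → ℂ)
    (hV : IsEuclidTrigVSystem dotc A c) {α x : Fin N → ℂ} (hα : α ∈ A)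
    (hx : Complex.sin (dotc α x) = 0) (a b a' b' : Fin N → ℂ) :
    residueSum A c α a b a' b' x = 0 := by
  classical
  obtain ⟨n, hn⟩ := Complex.sin_eq_zero_iff.mp hx
  let R : Setoid (Fin N → ℂ) :=
    { r := fun β γ => ∃ m : ℤ, β = γ + (m : ℂ) • α ∨ β = -γ + (m : ℂ) • α
      iseqv :=
        { refl := fun β => ⟨0, Or.inl (by simp)⟩
          symm := by
            rintro β γ ⟨m, rfl | rfl⟩
            · exact ⟨-m, Or.inl (by push_cast; module)⟩
            · exact ⟨m, Or.inr (by module)⟩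
          trans := by
            rintro β γ η ⟨m, rfl | rfl⟩ ⟨l, rfl | rfl⟩
            · exact ⟨m + l, Or.inl (by push_cast; module)⟩
            · exact ⟨m + l, Or.inr (by push_cast; module)⟩
            · exact ⟨m - l, Or.inr (by push_cast; module)⟩
            · exact ⟨m - l, Or.inl (by push_cast; module)⟩ } }
  refine Finset.sum_cancels_of_partition_cancels R fun β₀ hβ₀ => ?_
  have hRdef : ∀ β γ, R β γ ↔ ∃ m : ℤ, β = γ + (m : ℂ) • α ∨ β = -γ + (m : ℂ) • α :=
    fun _ _ => Iff.rfl
  have hstring : IsString A α ((A.filter (¬ Collin α ·)).filter (R · β₀)) := by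
    refine ⟨⟨β₀, by simp [Finset.mem_filter.mp hβ₀]⟩, fun γ hγ => ?_,
      fun γ₁ h₁ γ₂ h₂ => ?_, fun γ hγ β hβ hc hβγ => ?_⟩
    · simpa using (Finset.mem_filter.mp hγ).1
    · obtain ⟨m, hm⟩ := R.trans (Finset.mem_filter.mp h₁).2 (R.symm (Finset.mem_filter.mp h₂).2)
      exact ⟨m, hm.symm.imp (fun h => by rw [h]; module) (fun h => by rw [h]; module)⟩
    · exact Finset.mem_filter.mpr ⟨by simp [hβ, hc],
        R.trans (a := β) (b := γ) hβγ (Finset.mem_filter.mp hγ).2⟩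
  have key := hV α hα _ hstring a b
  calc _ = ∑ β ∈ (A.filter (¬ Collin α ·)).filter (R · β₀),
        c β * dotc α β * (dotc α a * dotc β b - dotc α b * dotc β a) *
          (wedge α β₀ a' b' * ccot (dotc β₀ x)) := by
        refine Finset.sum_congr rfl fun β hβ => ?_
        have : wedge α β a' b' * ccot (dotc β x) = wedge α β₀ a' b' * ccot (dotc β₀ x) := by
          obtain ⟨m, h | h⟩ := (hRdef _ _).mp (Finset.mem_filter.mp hβ).2
          · have h1 := wedge_smul_add_right α β₀ a' b' 1 m
            rw [one_smul, ← h, one_mul] at h1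
            rw [h1, h, dotc_add_left, dotc_smul_left, hn, ← mul_assoc, ← Int.cast_mul,
              ccot_add_int_mul_pi]
          · have h1 := wedge_smul_add_right α β₀ a' b' (-1) m
            rw [neg_one_smul, ← h] at h1
            rw [h1, h, dotc_add_left, dotc_smul_left, hn, ← mul_assoc, ← Int.cast_mul,
              ccot_add_int_mul_pi, dotc_neg_left, ccot_neg]
            ring
        rw [← this, wedge]; ring
    _ = 0 := by rw [← Finset.sum_mul, key, zero_mul]

/-- The additive group of points where `(α, x) ∈ π ℤ`. -/
def wallGroup (α : Fin N → ℂ) : AddSubgroup (Fin N → ℂ) where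
  carrier := {x | ∃ n : ℤ, dotc α x = n * Real.pi}
  zero_mem' := ⟨0, by simp [dotc]⟩
  add_mem' := by
    rintro x y ⟨n, hn⟩ ⟨m, hm⟩
    exact ⟨n + m, by rw [dotc_add_right, hn, hm]; push_cast; ring⟩
  neg_mem' := by
    rintro x ⟨n, hn⟩
    exact ⟨-n, by rw [← neg_one_smul ℂ x, dotc_smul_right, hn]; push_cast; ring⟩

/-- The character `x ↦ exp (2 i (β, x))` of `wallGroup α`. -/
noncomputable def wallChar (α β : Fin N → ℂ) : Multiplicative (wallGroup α) →* ℂ where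
  toFun x := Complex.exp (2 * Complex.I * dotc β (x.toAdd : Fin N → ℂ))
  map_one' := by simp [dotc]
  map_mul' x y := by
    rw [← Complex.exp_add]
    simp [dotc_add_right, mul_add]

lemma wallChar_eq_iff {α : Fin N → ℂ} (hα : α ≠ 0) (β γ : Fin N → ℂ) :
    wallChar α β = wallChar α γ ↔ ∃ m : ℤ, β = γ + (m : ℂ) • α := by
  have happ : ∀ β x (hx : x ∈ wallGroup α), wallChar α β (Multiplicative.ofAdd ⟨x, hx⟩) =
      Complex.exp (2 * Complex.I * dotc β x) := fun _ _ _ => rfl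
  constructor
  · intro h
    have hdiff : ∀ x ∈ wallGroup α, ∃ n : ℤ, dotc (β - γ) x = n * Real.pi := fun x hx => by
      have h1 := DFunLike.congr_fun h (Multiplicative.ofAdd ⟨x, hx⟩)
      rw [happ, happ, Complex.exp_eq_exp_iff_exists_int] at h1
      obtain ⟨n, hn⟩ := h1
      refine ⟨n, mul_left_cancel₀ (mul_ne_zero two_ne_zero Complex.I_ne_zero) ?_⟩
      rw [dotc_sub_left, mul_sub, hn]; ring
    have hcol : Collin α (β - γ) := by
      by_contra hc
      obtain ⟨w, hw, hw'⟩ := exists_dotc_eq_zero_and_ne_zero hc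
      obtain ⟨n, hn⟩ := hdiff ((1 / dotc (β - γ) w) • w)
        ⟨0, by rw [dotc_smul_right, hw]; simp⟩
      rw [dotc_smul_right, one_div_mul_cancel hw'] at hn
      have hn' : (1 : ℝ) = n * Real.pi := by exact_mod_cast hn
      have hpos : 0 < n := by
        by_contra! hle
        have : (n : ℝ) ≤ 0 := by exact_mod_cast hle
        nlinarith [Real.pi_pos]
      have : (1 : ℝ) ≤ n := by exact_mod_cast hpos
      nlinarith [Real.pi_gt_three]
    obtain ⟨k, hk⟩ := hcol
    obtain ⟨v, hv⟩ := exists_dotc_ne_zero hα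
    obtain ⟨n, hn⟩ := hdiff ((Real.pi / dotc α v) • v)
      ⟨1, by rw [dotc_smul_right, div_mul_cancel₀ _ hv]; simp⟩
    rw [hk, dotc_smul_left, dotc_smul_right, div_mul_cancel₀ _ hv] at hn
    refine ⟨n, ?_⟩
    rw [← mul_right_cancel₀ (by exact_mod_cast Real.pi_ne_zero) hn, ← hk]; module
  · rintro ⟨m, rfl⟩
    refine DFunLike.ext _ _ fun x => ?_
    obtain ⟨⟨x, hx⟩, rfl⟩ := Multiplicative.ofAdd.surjective x
    obtain ⟨n, hn⟩ := id hx
    rw [happ, happ, dotc_add_left, dotc_smul_left, hn, Complex.exp_eq_exp_iff_exists_int]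
    exact ⟨m * n, by push_cast; ring⟩

/-- If the residues of the commutator along the walls `(α, x) ∈ π ℤ` vanish, then every
`α`-string cancels. -/
lemma string_sum_eq_zero (A : Finset (Fin N → ℂ)) (c : (Fin N → ℂ) → ℂ) {α : Fin N → ℂ}
    (hα : α ≠ 0) (a b : Fin N → ℂ)
    (hres : ∀ a' b' x, Complex.sin (dotc α x) = 0 →
      (∀ β ∈ A, ¬ Collin α β → Complex.sin (dotc β x) ≠ 0) → residueSum A c α a b a' b' x = 0)
    {Γ : Finset (Fin N → ℂ)} (hΓ : IsString A α Γ) :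
    ∑ β ∈ Γ, c β * dotc α β * (dotc α a * dotc β b - dotc α b * dotc β a) = 0 := by
  classical
  obtain ⟨⟨β₀, hβ₀⟩, hΓA, hΓrel, hΓmax⟩ := hΓ
  obtain ⟨a', b', hw⟩ := exists_wedge_ne_zero hα (hΓA β₀ hβ₀).2
  set A' := A.filter (¬ Collin α ·) with hA'
  have hmem : ∀ β, β ∈ A' ↔ β ∈ A ∧ ¬ Collin α β := fun β => by simp [hA']
  obtain ⟨w, hαw, hgen⟩ := exists_generic α
    ((A' ∪ ((A' ×ˢ A').image fun p => p.1 - p.2) ∪ ((A' ×ˢ A').image fun p => p.1 + p.2)).filter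
      (¬ Collin α ·)) (fun s hs => (Finset.mem_filter.mp hs).2)
  have hgen₁ : ∀ β ∈ A', (dotc β w).re ≠ 0 := fun β hβ => hgen β <| by
    simp only [Finset.mem_filter, Finset.mem_union]
    exact ⟨Or.inl (Or.inl hβ), ((hmem β).mp hβ).2⟩
  have hcol0 : ∀ {β}, Collin α β → dotc β w = 0 := by
    rintro _ ⟨k, rfl⟩; rw [dotc_smul_left, hαw, mul_zero]
  have hsub : ∀ β ∈ A', ∀ γ ∈ A', (dotc (β - γ) w).re = 0 → dotc (β - γ) w = 0 :=
    fun β hβ γ hγ h0 => by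
      by_contra hne
      refine hgen (β - γ) ?_ h0
      simp only [Finset.mem_filter, Finset.mem_union, Finset.mem_image]
      exact ⟨Or.inl (Or.inr ⟨(β, γ), by simp [hβ, hγ], rfl⟩), fun hc => hne (hcol0 hc)⟩
  have hadd : ∀ β ∈ A', ∀ γ ∈ A', (dotc (β + γ) w).re = 0 → dotc (β + γ) w = 0 :=
    fun β hβ γ hγ h0 => by
      by_contra hne
      refine hgen (β + γ) ?_ h0
      simp only [Finset.mem_filter, Finset.mem_union, Finset.mem_image]
      exact ⟨Or.inr ⟨(β, γ), by simp [hβ, hγ], rfl⟩, fun hc => hne (hcol0 hc)⟩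
  -- the sign making `β` positive in the direction `w`
  set s : (Fin N → ℂ) → ℤ := fun β => if 0 < (dotc β w).re then 1 else -1 with hs
  have hs1 : ∀ β, s β = 1 ∨ s β = -1 := fun β => by
    simp only [hs]; split_ifs <;> simp
  have hspos : ∀ β ∈ A', 0 < (dotc ((s β : ℂ) • β) w).re := fun β hβ => by
    simp only [hs, dotc_smul_left]
    split_ifs with h
    · simpa using h
    · simpa using lt_of_le_of_ne (not_lt.mp h) (hgen₁ β hβ)
  set d : (Fin N → ℂ) → ℂ := fun β => s β * (c β * dotc α β * wedge α β a b * wedge α β a' b')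
    with hd
  set χ : (Fin N → ℂ) → Multiplicative (wallGroup α) →* ℂ := fun β => wallChar α ((s β : ℂ) • β)
    with hχ
  set e : (Multiplicative (wallGroup α) →* ℂ) → ℂ := fun ψ => ∑ β ∈ A' with χ β = ψ, d β with he
  have htw : ∀ t : ℝ, (Complex.I * t) • w ∈ wallGroup α := fun t =>
    ⟨0, by rw [dotc_smul_right, hαw]; simp⟩
  have hpw : ∀ β, ∀ t : ℝ, χ β (Multiplicative.ofAdd ⟨_, htw t⟩) =
      Complex.exp (-(2 * dotc ((s β : ℂ) • β) w * t)) := fun β t => by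
    change Complex.exp (2 * Complex.I * dotc ((s β : ℂ) • β) ((Complex.I * t) • w)) = _
    rw [dotc_smul_right]
    congr 1
    linear_combination (2 * dotc ((s β : ℂ) • β) w * t) * Complex.I_mul_I
  -- the contraction rate of a character along the path, well defined on the characters `χ β`
  choose! lift hlift using fun (ψ : Multiplicative (wallGroup α) →* ℂ) (h : ψ ∈ A'.image χ) =>
    Finset.mem_image.mp h
  have hzero := coeff_eq_zero_of_sum_cayley_eq_zero (A'.image χ) e
    (fun t => Multiplicative.ofAdd ⟨_, htw t⟩)
    (fun ψ => 2 * dotc ((s (lift ψ) : ℂ) • lift ψ) w)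
    (fun ψ hψ t => by rw [← hpw, (hlift ψ hψ).2])
    (fun ψ hψ => by simpa using hspos _ (hlift ψ hψ).1)
    (fun ψ hψ ψ' hψ' hre => by
      have h1 := (hlift ψ hψ).1
      have h2 := (hlift ψ' hψ').1
      generalize lift ψ = β at h1 hre ⊢
      generalize lift ψ' = γ at h2 hre ⊢
      congr 1
      simp only [dotc_smul_left] at hre ⊢
      have e1 := hsub β h1 γ h2
      have e2 := hadd β h1 γ h2
      simp only [dotc_sub_left, dotc_add_left] at e1 e2
      rcases hs1 β with hβ | hβ <;> rcases hs1 γ with hγ | hγ <;>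
        simp only [hβ, hγ, Int.cast_one, Int.cast_neg, one_mul, neg_mul, Complex.mul_re,
          Complex.re_ofNat, Complex.im_ofNat, zero_mul, sub_zero, Complex.neg_re] at hre ⊢
      · linear_combination e1 (by rw [Complex.sub_re]; linarith)
      · linear_combination e2 (by rw [Complex.add_re]; linarith)
      · linear_combination -e2 (by rw [Complex.add_re]; linarith)
      · linear_combination -e1 (by rw [Complex.sub_re]; linarith))
    (fun y hy => by
      obtain ⟨⟨x, n, hn⟩, rfl⟩ := Multiplicative.ofAdd.surjective y
      have hχx : ∀ β, χ β (Multiplicative.ofAdd ⟨x, n, hn⟩) =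
        Complex.exp (2 * Complex.I * dotc ((s β : ℂ) • β) x) := fun _ => rfl
      have hcot : ∀ β, s β * ccot (dotc ((s β : ℂ) • β) x) = ccot (dotc β x) := fun β => by
        rcases hs1 β with h | h <;> simp [h, dotc_neg_left, ccot_neg]
      have hr := hres a' b' x (Complex.sin_eq_zero_iff.mpr ⟨n, hn⟩) (fun β hβ hc => by
        have h1 := hy (χ β) (Finset.mem_image_of_mem χ ((hmem β).mpr ⟨hβ, hc⟩))
        rw [hχx] at h1
        have h2 := sin_ne_zero_of_exp_ne_one h1
        rcases hs1 β with h | h <;> simpa [h, dotc_neg_left] using h2)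
      have hI : ∑ β ∈ A', d β * ((1 + χ β (Multiplicative.ofAdd ⟨x, n, hn⟩)) /
          (1 - χ β (Multiplicative.ofAdd ⟨x, n, hn⟩))) = 0 := by
        refine (mul_eq_zero.mp (?_ : -Complex.I * _ = 0)).resolve_left
          (neg_ne_zero.mpr Complex.I_ne_zero)
        rw [← hr, residueSum, Finset.mul_sum]
        refine Finset.sum_congr rfl fun β _ => ?_
        rw [← hcot β, ccot_eq_exp, hχx]
        simp only [hd]; ring
      rw [← hI, ← Finset.sum_fiberwise_of_maps_to
        (fun β hβ => Finset.mem_image_of_mem χ hβ)]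
      refine Finset.sum_congr rfl fun ψ _ => ?_
      rw [he, Finset.sum_mul]
      refine Finset.sum_congr rfl fun β hβ => ?_
      rw [(Finset.mem_filter.mp hβ).2])
  have hΓ' : ∀ β ∈ Γ, β ∈ A' := fun β hβ => (hmem β).mpr (hΓA β hβ)
  have hβ₀' := hΓ' β₀ hβ₀
  have hclass : ∀ β ∈ A', (χ β = χ β₀ ↔ β ∈ Γ) := fun β hβ => by
    rw [hχ, wallChar_eq_iff hα]
    constructor
    · rintro ⟨m, hm⟩
      refine hΓmax β₀ hβ₀ β ((hmem β).mp hβ).1 ((hmem β).mp hβ).2 ?_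
      rcases hs1 β with h | h <;> rcases hs1 β₀ with h' | h' <;>
        simp only [h, h', Int.cast_one, Int.cast_neg, one_smul, neg_smul] at hm
      · exact ⟨m, Or.inl hm⟩
      · exact ⟨m, Or.inr hm⟩
      · exact ⟨-m, Or.inr (by rw [← neg_neg β, hm]; push_cast; module)⟩
      · exact ⟨-m, Or.inl (by rw [← neg_neg β, hm]; push_cast; module)⟩
    · intro hβΓ
      have p1 := hspos β hβ
      have p2 := hspos β₀ hβ₀'
      obtain ⟨m, hm | hm⟩ := hΓrel β hβΓ β₀ hβ₀
      · have hβe : β = -β₀ + (m : ℂ) • α := by rw [← hm]; module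
        have hdot : dotc β w = -dotc β₀ w := by
          rw [hβe, dotc_add_left, dotc_neg_left, dotc_smul_left, hαw, mul_zero, add_zero]
        rw [dotc_smul_left, hdot] at p1
        rw [dotc_smul_left] at p2
        rcases hs1 β with h | h <;> rcases hs1 β₀ with h' | h' <;>
          simp only [h, h', Int.cast_one, Int.cast_neg, one_smul, neg_smul] at p1 p2 ⊢
        · simp at p1 p2; linarith
        · exact ⟨m, hβe⟩
        · exact ⟨-m, by rw [hβe]; push_cast; module⟩
        · simp at p1 p2; linarith
      · have hβe : β = β₀ + (m : ℂ) • α := by rw [← hm]; module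
        have hdot : dotc β w = dotc β₀ w := by
          rw [hβe, dotc_add_left, dotc_smul_left, hαw, mul_zero, add_zero]
        rw [dotc_smul_left, hdot] at p1
        rw [dotc_smul_left] at p2
        rcases hs1 β with h | h <;> rcases hs1 β₀ with h' | h' <;>
          simp only [h, h', Int.cast_one, Int.cast_neg, one_smul, neg_smul] at p1 p2 ⊢
        · exact ⟨m, hβe⟩
        · simp at p1 p2; linarith
        · simp at p1 p2; linarith
        · exact ⟨-m, by rw [hβe]; push_cast; module⟩
  have hfinal := hzero (χ β₀) (Finset.mem_image_of_mem χ hβ₀')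
  have hset : A'.filter (χ · = χ β₀) = Γ := by
    ext β
    rw [Finset.mem_filter]
    exact ⟨fun h => (hclass β h.1).mp h.2, fun h => ⟨hΓ' β h, (hclass β (hΓ' β h)).mpr h⟩⟩
  simp only [he, hset] at hfinal
  have hwedge : ∀ β ∈ Γ, (s β : ℂ) * wedge α β a' b' = s β₀ * wedge α β₀ a' b' := fun β hβ => by
    obtain ⟨m, hm⟩ := (wallChar_eq_iff hα _ _).mp ((hclass β (hΓ' β hβ)).mpr hβ)
    have h1 := wedge_smul_add_right α β a' b' (s β) 0
    have h2 := wedge_smul_add_right α β₀ a' b' (s β₀) m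
    rw [zero_smul, add_zero, hm] at h1
    rw [← h1, h2]
  rw [Finset.sum_congr rfl fun β hβ => show d β =
    c β * dotc α β * (dotc α a * dotc β b - dotc α b * dotc β a) *
      (s β₀ * wedge α β₀ a' b') by rw [← hwedge β hβ]; simp only [hd, wedge]; ring,
    ← Finset.sum_mul] at hfinal
  refine (mul_eq_zero.mp hfinal).resolve_right (mul_ne_zero ?_ hw)
  rcases hs1 β₀ with h | h <;> simp [h]

end Residues

section Periodic

/-- A `π`-periodic function on `ℂ` with removable singularities that decays at `± i ∞` vanishes
wherever it is continuous. -/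
lemma eq_zero_of_periodic_of_removable {g : ℂ → ℂ}
    (hdiff : ∀ t₀, ∀ᶠ t in 𝓝[≠] t₀, DifferentiableAt ℂ g t)
    (hres : ∀ t₀, Tendsto (fun t => t * g (t₀ + t)) (𝓝[≠] 0) (𝓝 0))
    (hper : ∀ t, g (t + Real.pi) = g t)
    (htop : Tendsto g (comap Complex.im atTop) (𝓝 0))
    (hbot : Tendsto g (comap Complex.im atBot) (𝓝 0))
    (hdtop : ∀ᶠ t in comap Complex.im atTop, ContinuousAt g t)
    (hdbot : ∀ᶠ t in comap Complex.im atBot, ContinuousAt g t)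
    {t : ℂ} (ht : ContinuousAt g t) : g t = 0 := by
  set h : ℂ → ℂ := fun t₀ => limUnder (𝓝[≠] t₀) g with hh
  have hlittle : ∀ t₀, (fun z => g z - g t₀) =o[𝓝[≠] t₀] fun z => (z - t₀)⁻¹ := fun t₀ => by
    have hsub : Tendsto (fun z => z - t₀) (𝓝[≠] t₀) (𝓝[≠] 0) := by
      refine tendsto_nhdsWithin_iff.mpr ⟨?_, ?_⟩
      · have : Continuous fun z : ℂ => z - t₀ := by fun_prop
        simpa using (this.tendsto t₀).mono_left nhdsWithin_le_nhds
      · filter_upwards [self_mem_nhdsWithin] with z hz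
        exact sub_ne_zero.mpr hz
    refine (Asymptotics.isLittleO_iff_tendsto' ?_).mpr ?_
    · filter_upwards [self_mem_nhdsWithin] with z hz h0
      exact absurd (inv_eq_zero.mp h0) (sub_ne_zero.mpr hz)
    · have h1 := (hres t₀).comp hsub
      have h2 := h1.sub ((tendsto_nhds_of_tendsto_nhdsWithin hsub).mul_const (g t₀))
      simp only [zero_mul, sub_zero] at h2
      refine h2.congr fun z => ?_
      simp only [Function.comp, add_sub_cancel, div_inv_eq_mul]
      ring
  have hlim : ∀ t₀, Tendsto g (𝓝[≠] t₀) (𝓝 (h t₀)) := fun t₀ =>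
    Complex.tendsto_limUnder_of_differentiable_on_punctured_nhds_of_isLittleO (hdiff t₀)
      (hlittle t₀)
  have heq : ∀ {t}, ContinuousAt g t → h t = g t := fun {t} hc =>
    tendsto_nhds_unique (hlim t) (hc.tendsto.mono_left nhdsWithin_le_nhds)
  have hdh : Differentiable ℂ h := fun t₀ => by
    have hs := eventually_nhdsWithin_iff.mp (hdiff t₀)
    have hD := Complex.differentiableOn_update_limUnder_of_isLittleO hs
      (fun z hz => (hz.1 hz.2).differentiableWithinAt) (hlittle t₀)
    refine (hD.differentiableAt hs).congr_of_eventuallyEq ?_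
    filter_upwards [hs] with z hz
    by_cases hzt : z = t₀
    · subst hzt; simp [hh]
    · rw [Function.update_of_ne hzt, heq (hz hzt).continuousAt]
  have hperh : ∀ t, h (t + Real.pi) = h t := fun t => by
    refine tendsto_nhds_unique ?_ (hlim t)
    have : Tendsto (fun z : ℂ => z + Real.pi) (𝓝[≠] t) (𝓝[≠] (t + Real.pi)) := by
      refine tendsto_nhdsWithin_iff.mpr ⟨?_, ?_⟩
      · have : Continuous fun z : ℂ => z + Real.pi := by fun_prop
        exact (this.tendsto t).mono_left nhdsWithin_le_nhds
      · filter_upwards [self_mem_nhdsWithin] with z hz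
        simpa using hz
    exact ((hlim _).comp this).congr fun z => hper z
  have htoph : Tendsto h (comap Complex.im atTop) (𝓝 0) :=
    htop.congr' (hdtop.mono fun t hc => (heq hc).symm)
  have hboth : Tendsto h (comap Complex.im atBot) (𝓝 0) :=
    hbot.congr' (hdbot.mono fun t hc => (heq hc).symm)
  have hev : ∀ᶠ r : ℝ in atTop, ∀ z : ℂ, z.im = r → ‖h z‖ < 1 := by
    simpa using eventually_comap.mp (htoph.norm.eventually_lt_const (by simp : ‖(0 : ℂ)‖ < 1))
  have hev' : ∀ᶠ r : ℝ in atBot, ∀ z : ℂ, z.im = r → ‖h z‖ < 1 := by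
    simpa using eventually_comap.mp (hboth.norm.eventually_lt_const (by simp : ‖(0 : ℂ)‖ < 1))
  obtain ⟨R₁, hR₁⟩ := eventually_atTop.mp hev
  obtain ⟨R₂, hR₂⟩ := eventually_atBot.mp hev'
  obtain ⟨C, hC⟩ := ((isCompact_Icc (a := (0 : ℝ)) (b := Real.pi)).reProdIm
    (isCompact_Icc (a := R₂) (b := R₁))).exists_bound_of_continuousOn hdh.continuous.continuousOn
  have hbdd : Bornology.IsBounded (Set.range h) := by
    refine isBounded_iff_forall_norm_le.mpr ⟨max C 1, ?_⟩
    rintro _ ⟨z, rfl⟩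
    by_cases h1 : R₁ ≤ z.im
    · exact (hR₁ _ h1 z rfl).le.trans (le_max_right _ _)
    by_cases h2 : z.im ≤ R₂
    · exact (hR₂ _ h2 z rfl).le.trans (le_max_right _ _)
    have hp : Function.Periodic (fun s : ℝ => h (s + z.im * Complex.I)) Real.pi := fun s => by
      change h (((s + Real.pi : ℝ) : ℂ) + z.im * Complex.I) = h (s + z.im * Complex.I)
      rw [← hperh (s + z.im * Complex.I)]
      push_cast
      ring_nf
    obtain ⟨y, hy, hyz⟩ := hp.exists_mem_Ico₀ Real.pi_pos z.re
    rw [Complex.re_add_im] at hyz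
    rw [hyz]
    refine (hC _ ?_).trans (le_max_left _ _)
    rw [Complex.mem_reProdIm]
    simpa using ⟨⟨hy.1, hy.2.le⟩, (not_le.mp h2).le, (not_le.mp h1).le⟩
  have hconst : ∀ z, h z = h t := fun z => hdh.apply_eq_apply_of_bounded hbdd z t
  have : (comap Complex.im atTop).NeBot :=
    comap_neBot fun s hs => by
      obtain ⟨r, hr⟩ := (inferInstance : (atTop : Filter ℝ).NeBot).nonempty_of_mem hs
      exact ⟨⟨0, r⟩, hr⟩
  rw [← heq ht]
  exact tendsto_nhds_unique ((tendsto_congr hconst).mpr tendsto_const_nhds) htoph |>.symm ▸ rfl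

end Periodic

section Commutator

variable {N : ℕ}

lemma tendsto_commSum {ι : Type*} {L : Filter ι} (A : Finset (Fin N → ℂ)) (c : (Fin N → ℂ) → ℂ)
    (a b a' b' : Fin N → ℂ) (x : ι → Fin N → ℂ) (κ : (Fin N → ℂ) → ℂ)
    (h : ∀ α ∈ A, Tendsto (fun i => ccot (dotc α (x i))) L (𝓝 (κ α))) :
    Tendsto (fun i => commSum A c a b a' b' (x i)) L
      (𝓝 (∑ α ∈ A, ∑ β ∈ A, pairWeight c a b a' b' α β * (κ α * κ β))) :=
  tendsto_finsetSum _ fun α hα => tendsto_finsetSum _ fun β hβ =>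
    ((h α hα).mul (h β hβ)).const_mul _

lemma differentiableAt_commSum_line (A : Finset (Fin N → ℂ)) (c : (Fin N → ℂ) → ℂ)
    (a b a' b' x w : Fin N → ℂ) {t : ℂ}
    (h : ∀ α ∈ A, Complex.sin (dotc α (x + t • w)) ≠ 0) :
    DifferentiableAt ℂ (fun t : ℂ => commSum A c a b a' b' (x + t • w)) t := by
  have hcot : ∀ α ∈ A, DifferentiableAt ℂ (fun t : ℂ => ccot (dotc α (x + t • w))) t :=
    fun α hα => by
      have hlin : DifferentiableAt ℂ (fun t : ℂ => dotc α (x + t • w)) t := by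
        simp only [dotc_add_right, dotc_smul_right]; fun_prop
      exact (differentiableAt_ccot (h α hα)).comp t hlin
  simp only [commSum]
  refine DifferentiableAt.fun_sum fun α hα => DifferentiableAt.fun_sum fun β hβ => ?_
  exact ((hcot α hα).mul (hcot β hβ)).const_mul _

/-- A half-space containing the positive system can be chosen integral on the lattice. -/
lemma exists_integral_direction (A : Finset (Fin N → ℂ)) (u : Fin N → (Fin N → ℂ))
    (hu : LinearIndependent ℂ u) (hlat : ∀ α ∈ A, ∃ m : Fin N → ℤ, α = ∑ i, (m i : ℂ) • u i)
    (ε : (Fin N → ℂ) → ℂ) (hε : ∀ α ∈ A, ε α = 1 ∨ ε α = -1)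
    (ℓ : (Fin N → ℂ) →ₗ[ℂ] ℂ) (hhalf : ∀ α ∈ A, 0 < (ℓ (ε α • α)).re) :
    ∃ w, ∀ α ∈ A, ∃ p : ℤ, dotc α w = p ∧ ((ε α = 1 ∧ 0 < p) ∨ (ε α = -1 ∧ p < 0)) := by
  choose! m hm using hlat
  set r : Fin N → ℝ := fun i => (ℓ (u i)).re with hr
  have hℓ : ∀ α ∈ A, (ℓ α).re = ∑ i, m α i * r i := fun α hα => by
    conv_lhs => rw [hm α hα]
    simp [map_sum, hr]
  have hev : ∀ᶠ n : ℕ in atTop, ∀ α ∈ A, (ε α = 1 ∧ 0 < ∑ i, m α i * ⌊n * r i⌋) ∨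
      (ε α = -1 ∧ ∑ i, m α i * ⌊n * r i⌋ < 0) := by
    refine (Finset.eventually_all A).mpr fun α hα => ?_
    have habs : (ℓ α).re ≠ 0 := fun h0 => by
      rcases hε α hα with h | h <;> simpa [h, h0] using hhalf α hα
    filter_upwards [(tendsto_natCast_atTop_atTop.atTop_mul_const
      (abs_pos.mpr habs)).eventually_gt_atTop (∑ i, |(m α i : ℝ)|)] with n hn
    have hbound : |((∑ i, m α i * ⌊n * r i⌋ : ℤ) : ℝ) - n * (ℓ α).re| ≤ ∑ i, |(m α i : ℝ)| := by
      rw [hℓ α hα, Finset.mul_sum]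
      push_cast
      rw [← Finset.sum_sub_distrib]
      refine (Finset.abs_sum_le_sum_abs _ _).trans (Finset.sum_le_sum fun i _ => ?_)
      rw [show (m α i : ℝ) * ⌊n * r i⌋ - n * (m α i * r i) = m α i * (⌊n * r i⌋ - n * r i) by ring,
        abs_mul]
      refine mul_le_of_le_one_right (abs_nonneg _) (abs_le.mpr ⟨?_, ?_⟩)
      · linarith [Int.lt_floor_add_one (n * r i)]
      · linarith [Int.floor_le (n * r i)]
    have hb := abs_le.mp hbound
    rcases hε α hα with h | h
    · have hpos : 0 < (ℓ α).re := by simpa [h] using hhalf α hα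
      rw [abs_of_pos hpos] at hn
      refine Or.inl ⟨h, ?_⟩
      have : (0 : ℝ) < (∑ i, m α i * ⌊n * r i⌋ : ℤ) := by linarith
      exact_mod_cast this
    · have hneg : (ℓ α).re < 0 := by simpa [h] using hhalf α hα
      rw [abs_of_neg hneg] at hn
      refine Or.inr ⟨h, ?_⟩
      have : ((∑ i, m α i * ⌊n * r i⌋ : ℤ) : ℝ) < 0 := by linarith
      exact_mod_cast this
  obtain ⟨n, hn⟩ := hev.exists
  have hU : IsUnit (Matrix.of u) := Matrix.linearIndependent_rows_iff_isUnit.mp hu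
  obtain ⟨w, hw⟩ := Matrix.mulVec_surjective_iff_isUnit.mpr hU (fun i => ((⌊n * r i⌋ : ℤ) : ℂ))
  refine ⟨w, fun α hα => ⟨∑ i, m α i * ⌊n * r i⌋, ?_, hn α hα⟩⟩
  have hdot : ∀ i, dotc (u i) w = (⌊n * r i⌋ : ℤ) := fun i => congrFun hw i
  conv_lhs => rw [hm α hα]
  change (∑ i, (m α i : ℂ) • u i) ⬝ᵥ w = _
  rw [sum_dotProduct]
  push_cast
  exact Finset.sum_congr rfl fun i _ => by rw [← hdot i]; exact smul_dotProduct _ _ _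

/-- The value of the commutator at `± i ∞` in terms of the signed weights. -/
lemma sum_sign_mul_eq_sum_pairWeight (A : Finset (Fin N → ℂ)) (c ε : (Fin N → ℂ) → ℂ)
    (a b a' b' : Fin N → ℂ) {z : ℂ} (hz : z ^ 2 = -1) :
    ∑ α ∈ A, ∑ β ∈ A, pairWeight c a b a' b' α β * (z * ε α * (z * ε β)) =
      -∑ α ∈ A, ∑ β ∈ A, (ε α * ε β) * c α * c β * dotc α β *
        (dotc α a * dotc β b - dotc α b * dotc β a) *
        (dotc α a' * dotc β b' - dotc α b' * dotc β a') := by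
  simp only [← Finset.sum_neg_distrib]
  refine Finset.sum_congr rfl fun α _ => Finset.sum_congr rfl fun β _ => ?_
  simp only [pairWeight, wedge]
  linear_combination (c α * c β * dotc α β * (dotc α a * dotc β b - dotc α b * dotc β a) *
        (dotc α a' * dotc β b' - dotc α b' * dotc β a') * ε α * ε β) * hz

/-- Vanishing of the commutator at generic points, from the string conditions and the vanishing of
its value at `i ∞`. -/
lemma commSum_eq_zero_of_generic (A : Finset (Fin N → ℂ)) (hA0 : ∀ α ∈ A, α ≠ 0)
    (c : (Fin N → ℂ) → ℂ) (hV : IsEuclidTrigVSystem dotc A c) (ε : (Fin N → ℂ) → ℂ)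
    (a b a' b' : Fin N → ℂ)
    (hinf : ∑ α ∈ A, ∑ β ∈ A, (ε α * ε β) * c α * c β * dotc α β *
        (dotc α a * dotc β b - dotc α b * dotc β a) *
        (dotc α a' * dotc β b' - dotc α b' * dotc β a') = 0)
    {w x : Fin N → ℂ} (hw : ∀ α ∈ A, ∃ p : ℤ, dotc α w = p ∧
      ((ε α = 1 ∧ 0 < p) ∨ (ε α = -1 ∧ p < 0)))
    (hx : ∀ α ∈ A, Complex.sin (dotc α x) ≠ 0)
    (hx₂ : ∀ α ∈ A, ∀ β ∈ A, ¬ Collin α β →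
      Complex.sin (dotc (dotc α w • β - dotc β w • α) x) ≠ 0) :
    commSum A c a b a' b' x = 0 := by
  have hw0 : ∀ α ∈ A, dotc α w ≠ 0 := fun α hα => by
    obtain ⟨p, hp, h⟩ := hw α hα
    rw [hp]
    have : p ≠ 0 := by omega
    exact_mod_cast this
  -- behaviour of the arguments `(α, x + t w)` as `t → ± i ∞`
  have him : ∀ α ∈ A, ∀ p : ℤ, dotc α w = p → ∀ t : ℂ,
      (dotc α (x + t • w)).im = (dotc α x).im + p * t.im := fun α _ p hp t => by
    rw [dotc_add_right, dotc_smul_right, hp, Complex.add_im, mul_comm t]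
    simp
  have hup : ∀ α ∈ A, Tendsto (fun t : ℂ => dotc α (x + t • w)) (comap Complex.im atTop)
        (comap Complex.im atTop) ∧ ε α = 1 ∧
        Tendsto (fun t : ℂ => dotc α (x + t • w)) (comap Complex.im atBot)
        (comap Complex.im atBot) ∨
      Tendsto (fun t : ℂ => dotc α (x + t • w)) (comap Complex.im atTop)
        (comap Complex.im atBot) ∧ ε α = -1 ∧
        Tendsto (fun t : ℂ => dotc α (x + t • w)) (comap Complex.im atBot)
        (comap Complex.im atTop) := fun α hα => by
    obtain ⟨p, hp, ⟨h1, h2⟩ | ⟨h1, h2⟩⟩ := hw α hα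
    · have hp' : (0 : ℝ) < p := by exact_mod_cast h2
      refine Or.inl ⟨tendsto_comap_iff.mpr ?_, h1, tendsto_comap_iff.mpr ?_⟩ <;>
        simp only [Function.comp_def, him α hα p hp]
      · exact tendsto_atTop_add_const_left _ _ (tendsto_comap.const_mul_atTop hp')
      · exact tendsto_atBot_add_const_left _ _ (tendsto_comap.const_mul_atBot hp')
    · have hp' : (p : ℝ) < 0 := by exact_mod_cast h2
      refine Or.inr ⟨tendsto_comap_iff.mpr ?_, h1, tendsto_comap_iff.mpr ?_⟩ <;>
        simp only [Function.comp_def, him α hα p hp]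
      · exact tendsto_atBot_add_const_left _ _ (tendsto_comap.const_mul_atTop_of_neg hp')
      · exact tendsto_atTop_add_const_left _ _ (tendsto_comap.const_mul_atBot_of_neg hp')
  have hdcont : ∀ {L : Filter ℂ}, (∀ᶠ t in L, ∀ α ∈ A, Complex.sin (dotc α (x + t • w)) ≠ 0) →
      ∀ᶠ t in L, ContinuousAt (fun t : ℂ => commSum A c a b a' b' (x + t • w)) t :=
    fun h => h.mono fun t ht => (differentiableAt_commSum_line A c a b a' b' x w ht).continuousAt
  have hshift : ∀ t₀ t : ℂ, x + t₀ • w + t • w = x + (t₀ + t) • w := fun t₀ t => by module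
  have hpunct : ∀ t₀ : ℂ, ∀ᶠ t in 𝓝[≠] t₀, ∀ α ∈ A,
      Complex.sin (dotc α (x + t • w)) ≠ 0 := fun t₀ => by
    have h1 := eventually_sin_line_ne_zero A (x + t₀ • w) w fun γ hγ _ => hw0 γ hγ
    have hsub : Tendsto (fun z => z - t₀) (𝓝[≠] t₀) (𝓝[≠] 0) := by
      refine tendsto_nhdsWithin_iff.mpr ⟨?_, ?_⟩
      · have : Continuous fun z : ℂ => z - t₀ := by fun_prop
        simpa using (this.tendsto t₀).mono_left nhdsWithin_le_nhds
      · filter_upwards [self_mem_nhdsWithin] with z hz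
        exact sub_ne_zero.mpr hz
    filter_upwards [hsub.eventually h1] with t ht
    simpa only [hshift, add_sub_cancel] using ht
  have hxt : ∀ α ∈ A, Complex.sin (dotc α (x + (0 : ℂ) • w)) ≠ 0 := by simpa using hx
  have hres : ∀ t₀ : ℂ, Tendsto (fun t => t * commSum A c a b a' b' (x + (t₀ + t) • w))
      (𝓝[≠] 0) (𝓝 0) := fun t₀ => by
    by_cases hp : ∃ α ∈ A, Complex.sin (dotc α (x + t₀ • w)) = 0
    · obtain ⟨α, hα, hα0⟩ := hp
      have hcol : ∀ γ ∈ A, Complex.sin (dotc γ (x + t₀ • w)) = 0 → Collin α γ := by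
        intro γ hγ hγ0
        by_contra hc
        obtain ⟨n, hn⟩ := Complex.sin_eq_zero_iff.mp hα0
        obtain ⟨m, hm⟩ := Complex.sin_eq_zero_iff.mp hγ0
        obtain ⟨p, hp, -⟩ := hw α hα
        obtain ⟨q, hq, -⟩ := hw γ hγ
        refine hx₂ α hα γ hγ hc (Complex.sin_eq_zero_iff.mpr ⟨p * m - q * n, ?_⟩)
        rw [dotc_add_right, dotc_smul_right] at hn hm
        rw [dotc_sub_left, dotc_smul_left, dotc_smul_left]
        rw [hp] at hn ⊢
        rw [hq] at hm ⊢
        push_cast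
        linear_combination (p : ℂ) * hm - (q : ℂ) * hn
      have := tendsto_mul_commSum A hA0 c a b a' b' (hw0 α hα) hcol
      rw [residueSum_eq_zero A c hV hα hα0, mul_zero] at this
      simpa only [hshift] using this
    · push Not at hp
      have h1 := (differentiableAt_commSum_line A c a b a' b' x w hp).continuousAt.tendsto
      have h2 : Tendsto (fun t : ℂ => t₀ + t) (𝓝[≠] 0) (𝓝 t₀) := by
        have : Continuous fun t : ℂ => t₀ + t := by fun_prop
        simpa using (this.tendsto 0).mono_left nhdsWithin_le_nhds
      have h3 : Tendsto (fun t : ℂ => t) (𝓝[≠] (0 : ℂ)) (𝓝 0) := nhdsWithin_le_nhds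
      simpa using h3.mul (h1.comp h2)
  have := eq_zero_of_periodic_of_removable
    (g := fun t : ℂ => commSum A c a b a' b' (x + t • w)) (t := 0)
    (fun t₀ => (hpunct t₀).mono fun t ht => differentiableAt_commSum_line A c a b a' b' x w ht)
    hres
    (fun t => by
      simp only [commSum]
      have hcot : ∀ α ∈ A, ccot (dotc α (x + (t + Real.pi) • w)) = ccot (dotc α (x + t • w)) :=
        fun α hα => by
          obtain ⟨p, hp, -⟩ := hw α hα
          rw [← ccot_add_int_mul_pi (dotc α (x + t • w)) p, ← hp]
          simp only [dotc_add_right, dotc_smul_right]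
          ring_nf
      exact Finset.sum_congr rfl fun α hα => Finset.sum_congr rfl fun β hβ => by
        rw [hcot α hα, hcot β hβ])
    (by
      have h := tendsto_commSum A c a b a' b' (L := comap Complex.im atTop)
        (fun t : ℂ => x + t • w) (fun α => -Complex.I * ε α) fun α hα => by
          rcases hup α hα with ⟨h1, h2, -⟩ | ⟨h1, h2, -⟩
          · simpa [h2, Function.comp_def] using tendsto_ccot_atTop.comp h1
          · simpa [h2, Function.comp_def] using tendsto_ccot_atBot.comp h1
      rwa [sum_sign_mul_eq_sum_pairWeight A c ε a b a' b' (by simp), hinf, neg_zero] at h)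
    (by
      have h := tendsto_commSum A c a b a' b' (L := comap Complex.im atBot)
        (fun t : ℂ => x + t • w) (fun α => Complex.I * ε α) fun α hα => by
          rcases hup α hα with ⟨-, h2, h1⟩ | ⟨-, h2, h1⟩
          · simpa [h2, Function.comp_def] using tendsto_ccot_atBot.comp h1
          · simpa [h2, Function.comp_def] using tendsto_ccot_atTop.comp h1
      rwa [sum_sign_mul_eq_sum_pairWeight A c ε a b a' b' (by simp), hinf, neg_zero] at h)
    (hdcont <| (Finset.eventually_all A).mpr fun α hα => by
      rcases hup α hα with ⟨h1, -, -⟩ | ⟨h1, -, -⟩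
      · exact h1.eventually eventually_sin_ne_zero_atTop
      · exact h1.eventually eventually_sin_ne_zero_atBot)
    (hdcont <| (Finset.eventually_all A).mpr fun α hα => by
      rcases hup α hα with ⟨-, -, h1⟩ | ⟨-, -, h1⟩
      · exact h1.eventually eventually_sin_ne_zero_atBot
      · exact h1.eventually eventually_sin_ne_zero_atTop)
    (differentiableAt_commSum_line A c a b a' b' x w hxt).continuousAt
  simpa using this

/-- The commutator vanishes off its poles if it vanishes at all points that avoid finitely many
additional families of walls. -/
lemma commSum_eq_zero_of_dense (A S : Finset (Fin N → ℂ)) (c : (Fin N → ℂ) → ℂ)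
    (a b a' b' : Fin N → ℂ) (hS : ∀ η ∈ S, η ≠ 0)
    (h : ∀ x, (∀ η ∈ S, Complex.sin (dotc η x) ≠ 0) → commSum A c a b a' b' x = 0)
    {x : Fin N → ℂ} (hx : ∀ α ∈ A, Complex.sin (dotc α x) ≠ 0) :
    commSum A c a b a' b' x = 0 := by
  obtain ⟨v, -, hv⟩ := exists_generic 0 S
    fun s hs => by rintro ⟨k, hk⟩; exact hS s hs (by simpa using hk)
  have hev := eventually_sin_line_ne_zero S x v fun γ hγ _ h0 => hv γ hγ (by simp [h0])
  have hlim := (differentiableAt_commSum_line A c a b a' b' x v (t := 0)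
    (by simpa using hx)).continuousAt.tendsto.mono_left (nhdsWithin_le_nhds (s := {0}ᶜ))
  simp only [zero_smul, add_zero] at hlim
  exact tendsto_nhds_unique hlim
    (tendsto_const_nhds.congr' (hev.mono fun t ht => (h _ ht).symm))

/-- The matrices `F_i` commute at `x` iff all contractions of their commutators vanish. -/
lemma tmat_commute_iff (A : Finset (Fin N → ℂ)) (c : (Fin N → ℂ) → ℂ) (x : Fin N → ℂ) :
    (∀ i j, Tmat A c x i * Tmat A c x j = Tmat A c x j * Tmat A c x i) ↔
      ∀ a b a' b', commSum A c a b a' b' x = 0 := by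
  have hhalf : ∀ a b a' b', commSum A c a b a' b' x = 2 * ∑ α ∈ A, ∑ β ∈ A,
      c α * c β * dotc α β * wedge α β a b * (dotc α a' * dotc β b') *
        (ccot (dotc α x) * ccot (dotc β x)) := fun a b a' b' => by
    rw [two_mul]
    nth_rewrite 2 [Finset.sum_comm]
    simp only [commSum, ← Finset.sum_add_distrib]
    refine Finset.sum_congr rfl fun α _ => Finset.sum_congr rfl fun β _ => ?_
    simp only [pairWeight, wedge, dotc_comm β α]; ring
  have hprod : ∀ i j p q, (Tmat A c x i * Tmat A c x j) p q = ∑ α ∈ A, ∑ β ∈ A,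
      c α * c β * dotc α β * (α i * β j) * (α p * β q) *
        (ccot (dotc α x) * ccot (dotc β x)) := fun i j p q => by
    simp only [Matrix.mul_apply, Tmat, Matrix.of_apply, Finset.sum_mul_sum]
    rw [Finset.sum_comm]
    refine Finset.sum_congr rfl fun α _ => ?_
    rw [Finset.sum_comm]
    refine Finset.sum_congr rfl fun β _ => ?_
    simp only [dotc, Finset.mul_sum, Finset.sum_mul]
    exact Finset.sum_congr rfl fun k _ => by ring
  have hcomm : ∀ i j p q, (Tmat A c x i * Tmat A c x j - Tmat A c x j * Tmat A c x i) p q =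
      ∑ α ∈ A, ∑ β ∈ A, c α * c β * dotc α β * (α i * β j - α j * β i) * (α p * β q) *
        (ccot (dotc α x) * ccot (dotc β x)) := fun i j p q => by
    rw [Matrix.sub_apply, hprod, hprod]
    simp only [← Finset.sum_sub_distrib]
    exact Finset.sum_congr rfl fun α _ => Finset.sum_congr rfl fun β _ => by ring
  constructor
  · intro h a b a' b'
    rw [hhalf]
    have : ∑ α ∈ A, ∑ β ∈ A, c α * c β * dotc α β * wedge α β a b * (dotc α a' * dotc β b') *
        (ccot (dotc α x) * ccot (dotc β x)) = ∑ i, ∑ j, ∑ p, ∑ q, a i * b j * a' p * b' q *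
          (Tmat A c x i * Tmat A c x j - Tmat A c x j * Tmat A c x i) p q := by
      have hexp : ∀ α β : Fin N → ℂ, wedge α β a b * (dotc α a' * dotc β b') =
          ∑ i, ∑ j, ∑ p, ∑ q, a i * b j * a' p * b' q *
            ((α i * β j - α j * β i) * (α p * β q)) := fun α β => by
        have hw : wedge α β a b = ∑ i, ∑ j, a i * b j * (α i * β j - α j * β i) := by
          simp only [wedge, dotc, Finset.sum_mul_sum]
          rw [Finset.sum_comm (f := fun i j => α i * b i * (β j * a j))]
          simp only [← Finset.sum_sub_distrib]
          exact Finset.sum_congr rfl fun _ _ => Finset.sum_congr rfl fun _ _ => by ring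
        have hd : dotc α a' * dotc β b' = ∑ p, ∑ q, a' p * b' q * (α p * β q) := by
          simp only [dotc, Finset.sum_mul_sum]
          exact Finset.sum_congr rfl fun _ _ => Finset.sum_congr rfl fun _ _ => by ring
        rw [hw, hd]
        simp only [Finset.sum_mul]
        refine Finset.sum_congr rfl fun _ _ => Finset.sum_congr rfl fun _ _ => ?_
        simp only [Finset.mul_sum]
        exact Finset.sum_congr rfl fun _ _ => Finset.sum_congr rfl fun _ _ => by ring
      have hpull : ∀ α β : Fin N → ℂ, c α * c β * dotc α β * wedge α β a b *
          (dotc α a' * dotc β b') * (ccot (dotc α x) * ccot (dotc β x)) =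
          ∑ i, ∑ j, ∑ p, ∑ q, a i * b j * a' p * b' q *
            (c α * c β * dotc α β * (α i * β j - α j * β i) * (α p * β q) *
              (ccot (dotc α x) * ccot (dotc β x))) := fun α β => by
        rw [mul_assoc _ (wedge α β a b), hexp]
        simp only [Finset.mul_sum, Finset.sum_mul]
        exact Finset.sum_congr rfl fun _ _ => Finset.sum_congr rfl fun _ _ =>
          Finset.sum_congr rfl fun _ _ => Finset.sum_congr rfl fun _ _ => by ring
      simp only [hpull, hcomm, Finset.mul_sum]
      have hswap : ∀ f : (Fin N → ℂ) → Fin N → ℂ, ∑ α ∈ A, ∑ i, f α i = ∑ i, ∑ α ∈ A, f α i :=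
        fun f => Finset.sum_comm
      simp only [hswap]
    rw [this]
    simp [h]
  · intro h i j
    refine sub_eq_zero.mp (Matrix.ext fun p q => ?_)
    have := h (Pi.single i 1) (Pi.single j 1) (Pi.single p 1) (Pi.single q 1)
    rw [hhalf] at this
    rw [hcomm]
    simpa [wedge, dotc_single] using this

end Commutator

/-- under the non-degeneracy conditions `C_δ^{α₀} ≠ 0`, the
commutativity equations for the trigonometric prepotential hold iff `(A,c)`
is a Euclidean trigonometric ∨-system and
`Σ_{α,β∈A₊} c_α c_β (α,β) B_{α,β}(a,b) (α∧β) = 0`, where the positive system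
`A₊` is obtained from `A` by the sign changes `α ↦ ε_α α` putting `A` into a
half-space. -/
theorem stmt2 {N : ℕ} (A : Finset (Fin N → ℂ)) (hA0 : ∀ α ∈ A, α ≠ 0)
    (c : (Fin N → ℂ) → ℂ)
    -- `A` lies in a lattice of rank `N`
    (u : Fin N → (Fin N → ℂ)) (hu : LinearIndependent ℂ u)
    (hlat : ∀ α ∈ A, ∃ m : Fin N → ℤ, α = ∑ i, (m i : ℂ) • u i)
    -- the non-degeneracy conditions `C_δ^{α₀} ≠ 0`
    (hC : ∀ α ∈ A, ∀ α₀ ∈ A, Collin α α₀ →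
      ∀ δ : Finset (Fin N → ℂ), δ.Nonempty → (∀ γ ∈ δ, γ ∈ A ∧ Collin α γ) →
      ∀ k : (Fin N → ℂ) → ℂ, (∀ γ ∈ δ, γ = k γ • α₀) →
        ∑ γ ∈ δ, c γ * (k γ) ^ 2 ≠ 0)
    -- the sign changes `ε` turning `A` into a positive system `A₊`
    (ε : (Fin N → ℂ) → ℂ) (hε : ∀ α ∈ A, ε α = 1 ∨ ε α = -1)
    (ℓ : (Fin N → ℂ) →ₗ[ℂ] ℂ) (hhalf : ∀ α ∈ A, 0 < (ℓ (ε α • α)).re) :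
    (∀ x, (∀ α ∈ A, Complex.sin (dotc α x) ≠ 0) →
      ∀ i j : Fin N, Tmat A c x i * Tmat A c x j = Tmat A c x j * Tmat A c x i)
    ↔
    (IsEuclidTrigVSystem dotc A c ∧
      ∀ a b a' b' : Fin N → ℂ,
        ∑ α ∈ A, ∑ β ∈ A,
          (ε α * ε β) * c α * c β * dotc α β *
            (dotc α a * dotc β b - dotc α b * dotc β a) *
            (dotc α a' * dotc β b' - dotc α b' * dotc β a') = 0) := by
  classical
  have hiff : (∀ x, (∀ α ∈ A, Complex.sin (dotc α x) ≠ 0) →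
      ∀ i j : Fin N, Tmat A c x i * Tmat A c x j = Tmat A c x j * Tmat A c x i) ↔
      ∀ x, (∀ α ∈ A, Complex.sin (dotc α x) ≠ 0) → ∀ a b a' b', commSum A c a b a' b' x = 0 :=
    forall₂_congr fun x _ => tmat_commute_iff A c x
  rw [hiff]
  constructor
  · intro h
    refine ⟨fun α hα Γ hΓ a b => string_sum_eq_zero A c (hA0 α hα) a b ?_ hΓ, fun a b a' b' => ?_⟩
    · intro a' b' x hαx hx
      obtain ⟨v, hv⟩ := exists_dotc_ne_zero (hA0 α hα)
      have hcol : ∀ γ ∈ A, Complex.sin (dotc γ x) = 0 → Collin α γ := fun γ hγ h0 => by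
        by_contra hc
        exact hx γ hγ hc h0
      have hlim := tendsto_mul_commSum A hA0 c a b a' b' hv hcol
      have hev := eventually_sin_line_ne_zero A x v fun γ hγ h0 =>
        (hcol γ hγ h0).dotc_ne_zero (hA0 γ hγ) hv
      have hz := tendsto_nhds_unique hlim (tendsto_const_nhds.congr'
        (hev.mono fun t ht => show (0 : ℂ) = t * commSum A c a b a' b' (x + t • v) by
          rw [h _ ht a b a' b', mul_zero]))
      refine (mul_eq_zero.mp hz).resolve_left (mul_ne_zero (div_ne_zero two_ne_zero hv) ?_)
      refine hC α hα α hα ⟨1, by simp⟩ _ ⟨α, by simp [hα, hαx]⟩ (fun γ hγ => ?_)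
        (fun γ => dotc γ v / dotc α v) fun γ hγ => ?_
      · obtain ⟨hγA, h0⟩ := Finset.mem_filter.mp hγ
        exact ⟨hγA, hcol γ hγA h0⟩
      · obtain ⟨hγA, h0⟩ := Finset.mem_filter.mp hγ
        exact (hcol γ hγA h0).eq_div_smul hv
    · set v : Fin N → ℂ := fun i => ℓ (Pi.single i 1) with hv
      have hℓ : ∀ α, ℓ α = dotc α v := fun α => by
        conv_lhs => rw [← Finset.univ_sum_single α]
        rw [map_sum]
        refine Finset.sum_congr rfl fun i _ => ?_
        rw [hv, ← smul_eq_mul, ← map_smul, ← Pi.single_smul, smul_eq_mul, mul_one]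
      have him : ∀ α, ∀ t : ℝ, (dotc α ((Complex.I * t) • v)).im = (ℓ α).re * t := fun α t => by
        rw [dotc_smul_right, ← hℓ]; simp [mul_comm]
      have hdir : ∀ α ∈ A,
          Tendsto (fun t : ℝ => dotc α ((Complex.I * t) • v)) atTop (comap Complex.im atTop) ∧
            ε α = 1 ∨
          Tendsto (fun t : ℝ => dotc α ((Complex.I * t) • v)) atTop (comap Complex.im atBot) ∧
            ε α = -1 := fun α hα => by
        have hpos := hhalf α hα
        rcases hε α hα with h1 | h1 <;> simp only [h1, one_smul, neg_smul, map_neg,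
          Complex.neg_re, Left.neg_pos_iff] at hpos
        · refine Or.inl ⟨tendsto_comap_iff.mpr ?_, h1⟩
          simp only [Function.comp_def, him]
          exact tendsto_id.const_mul_atTop hpos
        · refine Or.inr ⟨tendsto_comap_iff.mpr ?_, h1⟩
          simp only [Function.comp_def, him]
          exact tendsto_id.const_mul_atTop_of_neg hpos
      have hlim := tendsto_commSum A c a b a' b' (fun t : ℝ => (Complex.I * t) • v)
        (fun α => -Complex.I * ε α) (L := atTop) fun α hα => by
          rcases hdir α hα with ⟨h1, h2⟩ | ⟨h1, h2⟩
          · simpa [h2, Function.comp_def] using tendsto_ccot_atTop.comp h1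
          · simpa [h2, Function.comp_def] using tendsto_ccot_atBot.comp h1
      rw [sum_sign_mul_eq_sum_pairWeight A c ε a b a' b' (by simp)] at hlim
      have hev : ∀ᶠ t : ℝ in atTop, ∀ α ∈ A,
          Complex.sin (dotc α ((Complex.I * t) • v)) ≠ 0 :=
        (Finset.eventually_all A).mpr fun α hα => by
          rcases hdir α hα with ⟨h1, -⟩ | ⟨h1, -⟩
          · exact h1.eventually eventually_sin_ne_zero_atTop
          · exact h1.eventually eventually_sin_ne_zero_atBot
      exact neg_eq_zero.mp (tendsto_nhds_unique hlim
        (tendsto_const_nhds.congr' (hev.mono fun t ht => (h _ ht a b a' b').symm)))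
  · rintro ⟨hV, hinf⟩ x hx a b a' b'
    obtain ⟨w, hw⟩ := exists_integral_direction A u hu hlat ε hε ℓ hhalf
    refine commSum_eq_zero_of_dense A
      (A ∪ ((A ×ˢ A).filter fun p => ¬ Collin p.1 p.2).image
        fun p => dotc p.1 w • p.2 - dotc p.2 w • p.1) c a b a' b' ?_ (fun y hy => ?_) hx
    · intro η hη
      rcases Finset.mem_union.mp hη with hη | hη
      · exact hA0 η hη
      · obtain ⟨⟨α, β⟩, hp, rfl⟩ := Finset.mem_image.mp hη
        obtain ⟨hp, hc⟩ := Finset.mem_filter.mp hp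
        obtain ⟨p, hαp, hsign⟩ := hw α (Finset.mem_product.mp hp).1
        have hp0 : (p : ℂ) ≠ 0 := by
          have : p ≠ 0 := by omega
          exact_mod_cast this
        refine fun h0 => hc ⟨dotc β w / dotc α w, ?_⟩
        rw [← hαp] at hp0
        rw [div_eq_inv_mul, mul_smul, ← sub_eq_zero.mp h0, inv_smul_smul₀ hp0]
    · refine commSum_eq_zero_of_generic A hA0 c hV ε a b a' b' (hinf a b a' b') hw
        (fun α hα => hy α (Finset.mem_union_left _ hα)) fun α hα β hβ hc => hy _ ?_
      exact Finset.mem_union_right _ (Finset.mem_image.mpr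
        ⟨(α, β), Finset.mem_filter.mpr ⟨Finset.mem_product.mpr ⟨hα, hβ⟩, hc⟩, rfl⟩)
end

section
/- Let (A,c) be a Euclidean trigonometric ∨-system with ⟨A⟩ = V, and let V = V₁ ⊕ ⋯ ⊕ V_k be the eigenspace decomposition of the operator M = Σ_{β∈A} c_β β⊗β with M|_{V_i} = λ_i·Id, and set A_i = A ∩ V_i. Then: (a) for every i, the pair (A_i, c|_{A_i}) is well-distributed in V_i with respect to the restricted form (·,·)_i, i.e. G_{A_i,c}(u,v) = λ_i (u,v) for u,v ∈ V_i; (b) if the form G_{A_i,c} is non-degenerate on V_i (equivalently λ_i ≠ 0), then (A_i, c|_{A_i}) is a trigonometric ∨-system; (c) if G_{A,c} is non-degenerate on V then (A,c) is a trigonometric ∨-system. -/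
open scoped BigOperators

/-- The bilinear form `G_{A,c}(x,y) = Σ_{α∈A} c_α (α,x)(α,y)`. -/
noncomputable def GAform {V : Type*} [AddCommGroup V] [Module ℂ V]
    (g : V → V → ℂ) (A : Finset V) (c : V → ℂ) (x y : V) : ℂ :=
  ∑ α ∈ A, c α * g α x * g α y

/-- Two vectors belong to the same `α`-string when they agree up to sign modulo `ℤα`. -/
def stringSetoid {V : Type*} [AddCommGroup V] [Module ℂ V] (α : V) : Setoid V where
  r γ β := ∃ m : ℤ, β = γ + (m : ℂ) • α ∨ β = -γ + (m : ℂ) • α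
  iseqv := by
    refine ⟨fun γ => ⟨0, Or.inl (by simp)⟩, ?_, ?_⟩
    · rintro γ β ⟨m, rfl | rfl⟩
      · exact ⟨-m, Or.inl (by push_cast; module)⟩
      · exact ⟨m, Or.inr (by module)⟩
    · rintro γ β δ ⟨m, rfl | rfl⟩ ⟨n, rfl | rfl⟩
      · exact ⟨m + n, Or.inl (by push_cast; module)⟩
      · exact ⟨n - m, Or.inr (by push_cast; module)⟩
      · exact ⟨m + n, Or.inr (by push_cast; module)⟩
      · exact ⟨n - m, Or.inl (by push_cast; module)⟩

/-- The non-collinear part of a class of `stringSetoid α` in `A` is an `α`-string. -/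
lemma isString_filter_stringSetoid {V : Type*} [AddCommGroup V] [Module ℂ V]
    (A : Finset V) (α : V) [DecidablePred fun β => ¬ Collin α β]
    [DecidableRel (stringSetoid α)] {x : V} (hx : x ∈ A) (hxα : ¬ Collin α x) :
    IsString A α ((A.filter fun β => ¬ Collin α β).filter fun β => stringSetoid α β x) := by
  refine ⟨⟨x, by simp [hx, hxα, Setoid.refl]⟩, ?_, ?_, ?_⟩
  · intro γ hγ
    simpa using (Finset.mem_filter.1 hγ).1
  · intro γ₁ h₁ γ₂ h₂
    have h : stringSetoid α γ₂ γ₁ := (stringSetoid α).trans (Finset.mem_filter.1 h₂).2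
      ((stringSetoid α).symm (Finset.mem_filter.1 h₁).2)
    obtain ⟨m, rfl | rfl⟩ := h
    · exact ⟨m, Or.inr (by module)⟩
    · exact ⟨m, Or.inl (by module)⟩
  · intro γ hγ β hβ hαβ h
    have h : stringSetoid α γ β := h
    simp only [Finset.mem_filter]
    exact ⟨⟨hβ, hαβ⟩, (stringSetoid α).trans ((stringSetoid α).symm h) (Finset.mem_filter.1 hγ).2⟩

/-- Summing the Euclidean ∨-conditions over all `α`-strings of `A`. -/
lemma IsEuclidTrigVSystem.sum_eq_zero {V : Type*} [AddCommGroup V] [Module ℂ V]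
    {g : V →ₗ[ℂ] V →ₗ[ℂ] ℂ} {A : Finset V} {c : V → ℂ}
    (hA : IsEuclidTrigVSystem (fun u v => g u v) A c) {α : V} (hα : α ∈ A) (a b : V) :
    ∑ β ∈ A, c β * g α β * (g α a * g β b - g α b * g β a) = 0 := by
  classical
  rw [← Finset.sum_filter_add_sum_filter_not A (fun β => Collin α β)]
  have hcol : ∑ β ∈ A.filter (fun β => Collin α β),
      c β * g α β * (g α a * g β b - g α b * g β a) = 0 := by
    refine Finset.sum_eq_zero fun β hβ => ?_
    obtain ⟨t, rfl⟩ := (Finset.mem_filter.1 hβ).2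
    simp only [map_smul, LinearMap.smul_apply, smul_eq_mul]
    ring
  rw [hcol, zero_add]
  refine Finset.sum_cancels_of_partition_cancels (stringSetoid α) fun x hx => ?_
  rw [Finset.mem_filter] at hx
  exact hA α hα _ (isString_filter_stringSetoid A α hx.1 hx.2) a b

/-- A nonzero eigenvector of a linear map lies in one of the summands of an eigenspace
decomposition. -/
lemma exists_mem_of_eigenvector {K V ι : Type*} [Field K] [AddCommGroup V] [Module K V]
    (T : V →ₗ[K] V) (W : ι → Submodule K V) (lam : ι → K)
    (hlam : Function.Injective lam) (hind : iSupIndep W) (htop : (⨆ i, W i) = ⊤)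
    (heig : ∀ i, ∀ v ∈ W i, T v = lam i • v) {x : V} (hx : x ≠ 0) {μ : K}
    (hμ : T x = μ • x) : ∃ i, x ∈ W i := by
  have hmem : x ∈ ⨆ i, W i := htop ▸ Submodule.mem_top
  obtain ⟨f, hf, hsum⟩ := (Submodule.mem_iSup_iff_exists_finsupp W x).1 hmem
  have hsum : ∑ i ∈ f.support, f i = x := hsum
  have hzero : ∑ i ∈ f.support, (lam i - μ) • f i = 0 := by
    rw [← sub_eq_zero, ← hsum, map_sum, Finset.smul_sum, ← Finset.sum_sub_distrib] at hμ
    rw [← hμ]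
    exact Finset.sum_congr rfl fun i _ => by rw [heig i _ (hf i), sub_smul]
  have hlamμ : ∀ i ∈ f.support, lam i = μ := fun i hi =>
    sub_eq_zero.1 <| (smul_eq_zero.1 <|
      (iSupIndep_iff_finsetSum_eq_zero_imp_eq_zero W).1 hind f.support _
        (fun j _ => (W j).smul_mem _ (hf j)) hzero i hi).resolve_right (Finsupp.mem_support_iff.1 hi)
  obtain ⟨i, hi⟩ : f.support.Nonempty := by
    rw [Finset.nonempty_iff_ne_empty]
    rintro h
    exact hx (by rw [← hsum, h, Finset.sum_empty])
  refine ⟨i, hsum ▸ sum_mem fun j hj => ?_⟩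
  rw [← hlam ((hlamμ j hj).trans (hlamμ i hi).symm)]
  exact hf j

/-- A linear map that is symmetric for `g` has `g`-orthogonal eigenvectors. -/
lemma apply_eq_zero_of_eigenvectors {K V : Type*} [Field K] [AddCommGroup V] [Module K V]
    (g : V →ₗ[K] V →ₗ[K] K) (T : V → V) (hT : ∀ u v, g (T u) v = g u (T v))
    {x y : V} {μ ν : K} (hx : T x = μ • x) (hy : T y = ν • y) (hne : μ ≠ ν) : g x y = 0 := by
  have h := hT x y
  rw [hx, hy] at h
  simp only [map_smul, LinearMap.smul_apply, smul_eq_mul] at h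
  have h0 : (μ - ν) * g x y = 0 := by linear_combination h
  exact (mul_eq_zero.1 h0).resolve_left (sub_ne_zero.2 hne)

/-- relation between Euclidean trigonometric ∨-systems and
trigonometric ∨-systems via the eigenspace decomposition of
`M = Σ_{β∈A} c_β β⊗β`. -/
theorem stmt6 {V : Type*} [AddCommGroup V] [Module ℂ V]
    (g : V →ₗ[ℂ] V →ₗ[ℂ] ℂ)
    (hgsymm : ∀ u v : V, g u v = g v u)
    (hgnondeg : ∀ v : V, (∀ w : V, g v w = 0) → v = 0)
    (A : Finset V) (hA0 : ∀ α ∈ A, α ≠ 0) (c : V → ℂ)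
    (hA : IsEuclidTrigVSystem (fun u v => g u v) A c)
    (hspan : Submodule.span ℂ (A : Set V) = ⊤)
    (M : V → V) (hM : ∀ u : V, M u = ∑ β ∈ A, (c β * g β u) • β)
    -- the eigenspace decomposition `V = V₁ ⊕ ⋯ ⊕ V_k`, `M|_{V_i} = λ_i·Id`
    (k : ℕ) (Vs : Fin k → Submodule ℂ V) (lam : Fin k → ℂ)
    (hlam : Function.Injective lam)
    (hbot : ∀ i, Vs i ≠ ⊥)
    (hind : iSupIndep Vs) (htop : (⨆ i, Vs i) = ⊤)
    (heig : ∀ i, ∀ v ∈ Vs i, M v = lam i • v)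
    -- the components `A_i = A ∩ V_i`
    (Ai : Fin k → Finset V) (hAi : ∀ i, ∀ v : V, v ∈ Ai i ↔ v ∈ A ∧ v ∈ Vs i) :
    -- (a) each `A_i` is well-distributed in `V_i`: `G_{A_i,c} = λ_i (·,·)` on `V_i`
    (∀ i, ∀ u ∈ Vs i, ∀ v ∈ Vs i,
        GAform (fun u v => g u v) (Ai i) c u v = lam i * g u v) ∧
    -- (b) if `G_{A_i,c}` is non-degenerate on `V_i` (i.e. `λ_i ≠ 0`) then
    -- `A_i` is a trigonometric ∨-system in `V_i`
    (∀ i, lam i ≠ 0 →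
      ∀ α ∈ Ai i, ∀ Γ : Finset V, IsString (Ai i) α Γ →
        ∀ a ∈ Vs i, ∀ b ∈ Vs i,
          ∑ β ∈ Γ, c β * GAform (fun u v => g u v) (Ai i) c α β *
            (g α a * g β b - g α b * g β a) = 0) ∧
    -- (c) if `G_{A,c}` is non-degenerate on `V` then `A` is a trigonometric
    -- ∨-system
    ((∀ v : V, (∀ w : V, GAform (fun u v => g u v) A c v w = 0) → v = 0) →
      ∀ α ∈ A, ∀ Γ : Finset V, IsString A α Γ →
        ∀ a b : V,
          ∑ β ∈ Γ, c β * GAform (fun u v => g u v) A c α β *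
            (g α a * g β b - g α b * g β a) = 0) := by
  have hMg : ∀ u v : V, g (M u) v = GAform (fun u v => g u v) A c u v := by
    intro u v
    simp [hM, GAform, map_sum]
  have hMsymm : ∀ u v : V, g (M u) v = g u (M v) := by
    intro u v
    rw [hgsymm u, hMg, hMg]
    exact Finset.sum_congr rfl fun β _ => by ring
  let T : V →ₗ[ℂ] V := ∑ β ∈ A, (c β • g β).smulRight β
  have hT : ∀ u, T u = M u := by
    intro u
    simp [T, hM]
  have hcomp : ∀ α ∈ A, ∃ i, α ∈ Vs i := by
    intro α hα
    obtain ⟨a, ha⟩ : ∃ a, g α a ≠ 0 := by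
      by_contra! h
      exact hA0 α hα (hgnondeg α h)
    have hwedge : ∀ b, g α a * g (M α) b = g α b * g (M α) a := by
      intro b
      have h := hA.sum_eq_zero hα a b
      rw [hMg, hMg, GAform, GAform, Finset.mul_sum, Finset.mul_sum, ← sub_eq_zero,
        ← Finset.sum_sub_distrib, ← h]
      refine Finset.sum_congr rfl fun β _ => ?_
      rw [hgsymm α β]
      ring
    refine exists_mem_of_eigenvector T Vs lam hlam hind htop
      (fun i v hv => (hT v).trans (heig i v hv)) (hA0 α hα) (μ := g (M α) a / g α a) ?_
    rw [hT, ← sub_eq_zero]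
    refine hgnondeg _ fun b => ?_
    simp only [map_sub, map_smul, LinearMap.sub_apply, LinearMap.smul_apply, smul_eq_mul]
    field_simp
    linear_combination hwedge b
  have hG : ∀ i, ∀ u ∈ Vs i, ∀ v, GAform (fun u v => g u v) A c u v = lam i * g u v := by
    intro i u hu v
    rw [← hMg, heig i u hu]
    simp
  have hwell : ∀ i, ∀ u ∈ Vs i, ∀ v ∈ Vs i,
      GAform (fun u v => g u v) (Ai i) c u v = lam i * g u v := by
    intro i u hu v hv
    rw [← hG i u hu v]
    refine Finset.sum_subset (fun β hβ => ((hAi i β).1 hβ).1) fun β hβ hβi => ?_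
    obtain ⟨j, hj⟩ := hcomp β hβ
    have hji : j ≠ i := by
      rintro rfl
      exact hβi ((hAi j β).2 ⟨hβ, hj⟩)
    simp [apply_eq_zero_of_eigenvectors g M hMsymm (heig j β hj) (heig i u hu)
      (hlam.ne hji)]
  refine ⟨hwell, ?_, ?_⟩
  · intro i _ α hα Γ hΓ a _ b _
    obtain ⟨hαA, hαi⟩ := (hAi i α).1 hα
    have hΓi : ∀ γ ∈ Γ, γ ∈ Vs i := fun γ hγ => ((hAi i γ).1 (hΓ.2.1 γ hγ).1).2
    have hΓA : IsString A α Γ := by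
      obtain ⟨hne, hmem, hpair, hmax⟩ := hΓ
      refine ⟨hne, fun γ hγ => ⟨((hAi i γ).1 (hmem γ hγ).1).1, (hmem γ hγ).2⟩, hpair, ?_⟩
      intro γ hγ β hβ hαβ h
      refine hmax γ hγ β ((hAi i β).2 ⟨hβ, ?_⟩) hαβ h
      obtain ⟨m, rfl | rfl⟩ := h
      · exact add_mem (hΓi γ hγ) ((Vs i).smul_mem _ hαi)
      · exact add_mem (neg_mem (hΓi γ hγ)) ((Vs i).smul_mem _ hαi)
    rw [← mul_zero (lam i), ← hA α hαA Γ hΓA a b, Finset.mul_sum]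
    refine Finset.sum_congr rfl fun β hβ => ?_
    rw [hwell i α hαi β (hΓi β hβ)]
    ring
  · intro _ α hα Γ hΓ a b
    obtain ⟨i, hαi⟩ := hcomp α hα
    rw [← mul_zero (lam i), ← hA α hα Γ hΓ a b, Finset.mul_sum]
    refine Finset.sum_congr rfl fun β _ => ?_
    rw [hG i α hαi β]
    ring
end

section
/- Let F = F(x^1,…,x^N) satisfy the commutativity equations F_i F_j = F_j F_i for all i,j, fix i₀ ∈ {1,…,N}, and let P be the (N−1)×N matrix with rows (F_{i₀ i 1},…,F_{i₀ i N}) for i ∈ {1,…,N}, i ≠ i₀. Let r,t ∈ {1,…,N} with r < t and r,t ≠ i₀, and let Q be the N×N matrix obtained from P by inserting as the i₀-th row the row R_{i₀} = (F_{1 r t}, F_{2 r t}, …, F_{N r t}). Then det Q = 0. -/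
open scoped BigOperators

noncomputable def pd {N : ℕ} (i : Fin N) (f : (Fin N → ℂ) → ℂ) : (Fin N → ℂ) → ℂ :=
  fun x => fderiv ℂ f x (Pi.single i 1)

noncomputable def D3 {N : ℕ} (F : (Fin N → ℂ) → ℂ) (i p q : Fin N) (x : Fin N → ℂ) : ℂ :=
  pd i (pd p (pd q F)) x

noncomputable def Fmat {N : ℕ} (F : (Fin N → ℂ) → ℂ) (i : Fin N) (x : Fin N → ℂ) :
    Matrix (Fin N) (Fin N) ℂ :=
  Matrix.of fun p q => D3 F i p q x

/-- Anything commuting with a square matrix commutes with its adjugate. -/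
theorem Commute.matrix_adjugate_left {n R : Type*} [Fintype n] [DecidableEq n] [CommRing R]
    {A B : Matrix n n R} (h : Commute A B) : Commute A.adjugate B := by
  have of_regular {S : Type _} [CommRing S] {M L : Matrix n n S} (hM : IsLeftRegular M.det)
      (hML : Commute M L) : Commute M.adjugate L := by
    refine (Matrix.isRegular_of_isLeftRegular_det hM).left ?_
    change M * (M.adjugate * L) = M * (L * M.adjugate)
    rw [← mul_assoc, ← mul_assoc, hML.eq, mul_assoc L, Matrix.mul_adjugate, Matrix.smul_mul,
      Matrix.mul_smul, one_mul, mul_one]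
  let ev : Matrix n n (Polynomial R) →+* Matrix n n R := (Polynomial.evalRingHom 0).mapMatrix
  let c : Matrix n n R →+* Matrix n n (Polynomial R) := Polynomial.C.mapMatrix
  have ev_c (M : Matrix n n R) : ev (c M) = M := by
    ext i j; simp [ev, c]
  have ev_charmatrix : ev (-A).charmatrix = A := by
    ext i j; by_cases hij : i = j <;> simp [ev, hij]
  have hcomm : Commute (-A).charmatrix (c B) :=
    (Matrix.scalar_commute _ (fun _ => Commute.all _ _) _).sub_left (h.neg_left.map c)
  have := (of_regular (-A).charpoly_monic.isRegular.left hcomm).map ev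
  rwa [ev_c, RingHom.map_adjugate, ev_charmatrix] at this

open Matrix in
/-- If the slices of a totally symmetric tensor commute, then replacing row `i` of the `i`-th slice
by a fibre `c r t` with `r ≠ t` gives a singular matrix. -/
theorem Matrix.det_updateRow_eq_zero_of_commute_slices {n R : Type*} [Fintype n] [DecidableEq n]
    [CommRing R] (c : n → Matrix n n R) (hswap : ∀ i j k, c i j k = c j i k)
    (hsymm : ∀ i, (c i).IsSymm) (hcomm : ∀ i j, Commute (c i) (c j)) {i r t : n} (hrt : r ≠ t) :
    ((c i).updateRow i (c r t)).det = 0 := by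
  have hcol : c r t = c r *ᵥ Pi.single t 1 := by
    ext j; simp [(hsymm r).apply]
  calc ((c i).updateRow i (c r t)).det
      = ((c i).adjugate * c r) i t := by
        rw [← cramer_transpose_apply, (hsymm i).eq, cramer_eq_adjugate_mulVec, hcol, mulVec_mulVec,
          mulVec_single_one, col_apply]
    _ = (c r * (c i).adjugate) i t := by rw [(hcomm i r).matrix_adjugate_left.eq]
    _ = (c i * (c i).adjugate) r t := by
        simp only [mul_apply]
        exact Finset.sum_congr rfl fun k _ => by rw [hswap r i k]
    _ = 0 := by simp [mul_adjugate, hrt]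

theorem contDiff_pd {N : ℕ} {f : (Fin N → ℂ) → ℂ} (hf : ContDiff ℂ ⊤ f) (i : Fin N) :
    ContDiff ℂ ⊤ (pd i f) :=
  (hf.fderiv_right le_top).clm_apply contDiff_const

theorem pd_comm {N : ℕ} {f : (Fin N → ℂ) → ℂ} (hf : ContDiff ℂ ⊤ f) (i j : Fin N) :
    pd i (pd j f) = pd j (pd i f) := by
  have hd : Differentiable ℂ (fderiv ℂ f) :=
    (hf.fderiv_right (m := ⊤) le_top).differentiable (by simp)
  have pd_pd (k l : Fin N) (x : Fin N → ℂ) :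
      pd k (pd l f) x = fderiv ℂ (fderiv ℂ f) x (Pi.single k 1) (Pi.single l 1) := by
    unfold pd
    rw [fderiv_clm_apply (hd x) (differentiableAt_const _)]
    simp
  ext x
  rw [pd_pd, pd_pd]
  exact hf.contDiffAt.isSymmSndFDerivAt le_top _ _

theorem D3_swap_left {N : ℕ} {F : (Fin N → ℂ) → ℂ} (hF : ContDiff ℂ ⊤ F) (i p q : Fin N)
    (x : Fin N → ℂ) : D3 F i p q x = D3 F p i q x :=
  congrFun (pd_comm (contDiff_pd hF q) i p) x

theorem D3_swap_right {N : ℕ} {F : (Fin N → ℂ) → ℂ} (hF : ContDiff ℂ ⊤ F) (i p q : Fin N)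
    (x : Fin N → ℂ) : D3 F i p q x = D3 F i q p x := by
  unfold D3
  rw [pd_comm hF p q]

/-- the N×N matrix obtained from `P = (F_{i₀ i j})_{i ≠ i₀}` by
inserting at the `i₀`-th place the row `(F_{1rt},…,F_{Nrt})` is singular. -/
theorem stmt10 {N : ℕ} (F : (Fin N → ℂ) → ℂ) (hF : ContDiff ℂ ⊤ F)
    (hcomm : ∀ x, ∀ i j : Fin N, Fmat F i x * Fmat F j x = Fmat F j x * Fmat F i x)
    (i₀ r t : Fin N) (hrt : r < t) (hr : r ≠ i₀) (ht : t ≠ i₀)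
    (x : Fin N → ℂ)
    (Q : Matrix (Fin N) (Fin N) ℂ)
    (hQ : ∀ i j, Q i j = if i = i₀ then D3 F j r t x else D3 F i₀ i j x) :
    Q.det = 0 := by
  have hQ_eq : Q = (Fmat F i₀ x).updateRow i₀ (Fmat F r x t) := by
    ext i j
    rw [hQ, Matrix.updateRow_apply]
    split_ifs
    · exact (D3_swap_left hF j r t x).trans (D3_swap_right hF r j t x)
    · rfl
  rw [hQ_eq]
  exact Matrix.det_updateRow_eq_zero_of_commute_slices (fun i => Fmat F i x)
    (fun i p q => D3_swap_left hF i p q x)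
    (fun i => Matrix.IsSymm.ext fun p q => D3_swap_right hF i q p x)
    (fun i j => hcomm x i j) hrt.ne
end
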